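/- arXiv:2508.09341 — 2 statements merged into one kernel-verified Lean document; each statement's English description precedes it below -/
import Mathlib

section
/- Let m be a fixed positive integer and let n ≥ 6m. If n is even, then U^n_m = E^{6m}_{2m}; if n is odd, then U^n_m = E^{6m−3}_{2m−1} + E^{6m}_{2m}. Here U^n_m is the number of isomorphism classes of graphs with n vertices and N − ⌊n/2⌋ − m edges on which Lights Out is universally solvable, where N = n(n−1)/2. -/
open scoped Classical in
/-- The neighborhood matrix of a finite simple graph over the field `ZMod 2`:
the entry at `(i, j)` is `1` if `i = j` or `i` and `j` are adjacent, and `0` otherwise. -/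
noncomputable def nbhdMatrix {V : Type} [Fintype V] [DecidableEq V] (G : SimpleGraph V) :
    Matrix V V (ZMod 2) :=
  Matrix.of fun i j => if i = j ∨ G.Adj i j then 1 else 0

/-- Lights Out is universally solvable on a finite simple graph iff its neighborhood
matrix over `ZMod 2` is invertible. -/
def UniversallySolvable {V : Type} [Fintype V] [DecidableEq V] (G : SimpleGraph V) : Prop :=
  IsUnit (nbhdMatrix G)


/-- The setoid on graphs on `Fin n` satisfying a property `P`, identifying isomorphic
graphs. Its quotient is the set of isomorphism classes of graphs satisfying `P`. -/
def isoSetoid {n : ℕ} (P : SimpleGraph (Fin n) → Prop) :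
    Setoid {G : SimpleGraph (Fin n) // P G} where
  r G H := Nonempty (G.1 ≃g H.1)
  iseqv := ⟨fun _ => ⟨SimpleGraph.Iso.refl⟩,
            fun h => h.elim fun e => ⟨e.symm⟩,
            fun h₁ h₂ => h₁.elim fun e => h₂.elim fun f => ⟨e.trans f⟩⟩

/-- The excess degree of a graph `Γ` with `n` vertices:
`edeg(Γ) = i - n + ∑_{v ∈ VΓ} deg(v)`, where `i` is the number of isolated vertices. -/
noncomputable def excessDegree {n : ℕ} (G : SimpleGraph (Fin n)) : ℤ :=
  (({v : Fin n | ∀ w, ¬ G.Adj v w} : Set (Fin n)).ncard : ℤ) - (n : ℤ)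
    + ∑ v : Fin n, ((G.neighborSet v).ncard : ℤ)

/-- `E n d`: the number of isomorphism classes of graphs `Γ` with `n` vertices and excess
degree `d` for which Lights Out is universally solvable on the complement `Γᶜ`. -/
noncomputable def numExcess (n d : ℕ) : ℕ :=
  Nat.card (Quotient (isoSetoid fun G : SimpleGraph (Fin n) =>
    excessDegree G = (d : ℤ) ∧ UniversallySolvable Gᶜ))
/-- `U^n_m`: the number of isomorphism classes of graphs with `n` vertices and
`N - ⌊n/2⌋ - m` edges (where `N = n(n-1)/2`) on which Lights Out is universally
solvable. -/
noncomputable def numSolvableEdges (n m : ℕ) : ℕ :=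
  Nat.card (Quotient (isoSetoid fun G : SimpleGraph (Fin n) =>
    G.edgeSet.ncard = n * (n - 1) / 2 - n / 2 - m ∧ UniversallySolvable G))

open SimpleGraph Matrix

section Counting

/-- The map from the classes of graphs satisfying `P` to the classes of all graphs. -/
def isoClassInclusion {n : ℕ} (P : SimpleGraph (Fin n) → Prop) :
    Quotient (isoSetoid P) → Quotient (isoSetoid fun _ : SimpleGraph (Fin n) => True) :=
  Quotient.map' (fun G => ⟨G.1, trivial⟩) fun _ _ h => h

theorem isoClassInclusion_injective {n : ℕ} (P : SimpleGraph (Fin n) → Prop) :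
    Function.Injective (isoClassInclusion P) := by
  rintro ⟨G⟩ ⟨H⟩ h
  exact Quotient.sound (Quotient.exact h : Nonempty (G.1 ≃g H.1))

theorem card_isoClasses_eq_ncard {n : ℕ} (P : SimpleGraph (Fin n) → Prop) :
    Nat.card (Quotient (isoSetoid P)) = (Set.range (isoClassInclusion P)).ncard :=
  (Nat.card_range_of_injective (isoClassInclusion_injective P)).symm

/-- The number of isomorphism classes is additive over two properties that no two isomorphic
graphs can share. -/
theorem card_isoClasses_of_iff_or {n : ℕ} {P Q R : SimpleGraph (Fin n) → Prop}
    (h : ∀ G, P G ↔ Q G ∨ R G) (hQR : ∀ G H, Q G → R H → IsEmpty (G ≃g H)) :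
    Nat.card (Quotient (isoSetoid P)) =
      Nat.card (Quotient (isoSetoid Q)) + Nat.card (Quotient (isoSetoid R)) := by
  have hunion : Set.range (isoClassInclusion P) =
      Set.range (isoClassInclusion Q) ∪ Set.range (isoClassInclusion R) := by
    apply Set.Subset.antisymm
    · rintro _ ⟨⟨G⟩, rfl⟩
      rcases (h G.1).1 G.2 with hG | hG
      · exact Or.inl ⟨⟦⟨G.1, hG⟩⟧, rfl⟩
      · exact Or.inr ⟨⟦⟨G.1, hG⟩⟧, rfl⟩
    · rintro _ (⟨⟨G⟩, rfl⟩ | ⟨⟨G⟩, rfl⟩)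
      · exact ⟨⟦⟨G.1, (h _).2 (Or.inl G.2)⟩⟧, rfl⟩
      · exact ⟨⟦⟨G.1, (h _).2 (Or.inr G.2)⟩⟧, rfl⟩
  have hdisj : Disjoint (Set.range (isoClassInclusion Q)) (Set.range (isoClassInclusion R)) := by
    rw [Set.disjoint_left]
    rintro _ ⟨⟨G⟩, rfl⟩ ⟨⟨H⟩, hGH⟩
    obtain ⟨e⟩ : Nonempty (H.1 ≃g G.1) := Quotient.exact hGH
    exact (hQR G.1 H.1 G.2 H.2).false e.symm
  rw [card_isoClasses_eq_ncard, card_isoClasses_eq_ncard Q, card_isoClasses_eq_ncard R, hunion,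
    Set.ncard_union_eq hdisj (Set.toFinite _) (Set.toFinite _)]

/-- Two classes of graphs are equinumerous up to isomorphism when an operation matching the
defining properties preserves and reflects isomorphism and is onto up to isomorphism. -/
theorem card_isoClasses_congr {n k : ℕ} {P : SimpleGraph (Fin n) → Prop}
    {Q : SimpleGraph (Fin k) → Prop} (f : SimpleGraph (Fin n) → SimpleGraph (Fin k))
    (hf : ∀ G H, Nonempty (G ≃g H) ↔ Nonempty (f G ≃g f H))
    (hPQ : ∀ G, P G ↔ Q (f G)) (hQ : ∀ G H, Nonempty (G ≃g H) → Q G → Q H)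
    (hsurj : ∀ K, Q K → ∃ G, Nonempty (f G ≃g K)) :
    Nat.card (Quotient (isoSetoid P)) = Nat.card (Quotient (isoSetoid Q)) := by
  let F : Quotient (isoSetoid P) → Quotient (isoSetoid Q) :=
    Quotient.map' (fun G => ⟨f G.1, (hPQ _).1 G.2⟩) fun G H h => (hf G.1 H.1).1 h
  refine Nat.card_congr (Equiv.ofBijective F ⟨?_, ?_⟩)
  · rintro ⟨G⟩ ⟨H⟩ h
    exact Quotient.sound ((hf G.1 H.1).2 (Quotient.exact h))
  · rintro ⟨K⟩
    obtain ⟨G, ⟨e⟩⟩ := hsurj K.1 K.2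
    exact ⟨⟦⟨G, (hPQ G).2 (hQ _ _ ⟨e.symm⟩ K.2)⟩⟧, Quotient.sound ⟨e⟩⟩

end Counting

section Solvability

variable {V W : Type} [Fintype V] [DecidableEq V] [Fintype W] [DecidableEq W]

theorem universallySolvable_iff_det_ne_zero (G : SimpleGraph V) :
    UniversallySolvable G ↔ (nbhdMatrix G).det ≠ 0 := by
  rw [UniversallySolvable, Matrix.isUnit_iff_isUnit_det, isUnit_iff_ne_zero]

theorem SimpleGraph.Iso.universallySolvable_iff {G : SimpleGraph V} {H : SimpleGraph W}
    (e : G ≃g H) : UniversallySolvable G ↔ UniversallySolvable H := by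
  have h : nbhdMatrix G = (nbhdMatrix H).submatrix e.toEquiv e.toEquiv := by
    ext i j
    simp only [nbhdMatrix, Matrix.of_apply, Matrix.submatrix_apply]
    congr 1
    simp [e.map_adj_iff]
  rw [universallySolvable_iff_det_ne_zero, universallySolvable_iff_det_ne_zero, h,
    Matrix.det_submatrix_equiv_self]

/-- An isomorphism of graphs is an isomorphism of their complements. -/
def SimpleGraph.Iso.complement {V W : Type} {G : SimpleGraph V} {H : SimpleGraph W}
    (e : G ≃g H) : Gᶜ ≃g Hᶜ where
  toEquiv := e.toEquiv
  map_rel_iff' := by simp [SimpleGraph.compl_adj, e.map_adj_iff]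

/-- A symmetric matrix with zero diagonal and odd size is singular in characteristic two. -/
theorem Matrix.det_eq_zero_of_isSymm_of_odd_card (A : Matrix V V (ZMod 2)) (hA : A.IsSymm)
    (hdiag : ∀ i, A i i = 0) (hV : Odd (Fintype.card V)) : A.det = 0 := by
  have hsign : ∀ σ : Equiv.Perm V, ((Equiv.Perm.sign σ : ℤ) : ZMod 2) = 1 := by
    intro σ
    rcases Int.units_eq_one_or (Equiv.Perm.sign σ) with h | h <;> rw [h]
    · simp
    · decide
  rw [Matrix.det_apply']
  simp only [hsign, one_mul]
  have hinv : ∀ σ : Equiv.Perm V, ∏ i, A (σ⁻¹ i) i = ∏ i, A (σ i) i := by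
    intro σ
    rw [← Equiv.prod_comp σ]
    exact Finset.prod_congr rfl fun i _ => by simp [hA.apply]
  refine Finset.sum_involution (fun σ _ => σ⁻¹) (fun σ _ => ?_) (fun σ _ hσ hfix => hσ ?_)
    (fun _ _ => Finset.mem_univ _) (fun σ _ => inv_inv σ)
  · rw [hinv, CharTwo.add_self_eq_zero]
  · have hsq : σ ^ 2 ^ 1 = 1 := by
      rw [pow_one, sq]
      nth_rewrite 1 [← hfix]
      exact inv_mul_cancel σ
    obtain ⟨a, ha⟩ := Equiv.Perm.exists_fixed_point_of_prime (p := 2)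
      (by rwa [← even_iff_two_dvd, Nat.not_even_iff_odd]) hsq
    exact Finset.prod_eq_zero (Finset.mem_univ a) (by rw [ha, hdiag])

/-- Subtracting the all-ones matrix from a symmetric matrix over `ZMod 2` with zero diagonal and
even size does not change its determinant. -/
theorem Matrix.det_sub_allOnes_of_isSymm (A : Matrix V V (ZMod 2)) (hA : A.IsSymm)
    (hdiag : ∀ i, A i i = 0) (hV : Even (Fintype.card V)) :
    (A - Matrix.of fun _ _ => 1).det = A.det := by
  have hschur : (A - Matrix.of fun _ _ => 1).det =
      (Matrix.fromBlocks A (Matrix.of fun _ _ => 1) (Matrix.of fun _ _ => 1)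
        (1 : Matrix (Fin 1) (Fin 1) (ZMod 2))).det := by
    rw [Matrix.det_fromBlocks_one₂₂]
    congr 2
  have hzero : (Matrix.fromBlocks A (Matrix.of fun _ _ => 1) (Matrix.of fun _ _ => 1)
        (0 : Matrix (Fin 1) (Fin 1) (ZMod 2))).det = 0 := by
    apply Matrix.det_eq_zero_of_isSymm_of_odd_card
    · ext (i | i) (j | j) <;> simp [hA.apply]
    · rintro (i | i) <;> simp [hdiag]
    · simpa using hV.add_one
  have htri : (Matrix.fromBlocks A (Matrix.of fun _ _ => 1) 0
        (1 : Matrix (Fin 1) (Fin 1) (ZMod 2))).det = A.det := by simp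
  rw [hschur, ← htri, ← zero_add (Matrix.det (Matrix.fromBlocks A _ 0 _)), ← hzero]
  have hupdate : ∀ (C : Matrix (Fin 1) V (ZMod 2)) (D : Matrix (Fin 1) (Fin 1) (ZMod 2)),
      Matrix.fromBlocks A (Matrix.of fun _ _ => 1) C D =
        (Matrix.fromBlocks A (Matrix.of fun _ _ => 1) 0 0).updateRow (Sum.inr 0)
          (Sum.elim (C 0) (D 0)) := by
    intro C D
    ext (i | i) (j | j)
    · simp [Matrix.updateRow_apply]
    · simp [Matrix.updateRow_apply]
    · simp [Matrix.updateRow_apply, Subsingleton.elim i 0]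
    · simp [Matrix.updateRow_apply, Subsingleton.elim i 0]
  rw [hupdate (Matrix.of fun _ _ => 1) 1, hupdate (Matrix.of fun _ _ => 1) 0, hupdate 0 1,
    ← Matrix.det_updateRow_add]
  congr 2
  ext (j | j) <;> simp

theorem nbhdMatrix_compl_sum_top (G : SimpleGraph V) :
    nbhdMatrix (G ⊕g (⊤ : SimpleGraph W))ᶜ =
      Matrix.fromBlocks (nbhdMatrix Gᶜ) (Matrix.of fun _ _ => 1) (Matrix.of fun _ _ => 1) 1 := by
  ext (i | i) (j | j)
  · simp only [nbhdMatrix, Matrix.of_apply, Matrix.fromBlocks_apply₁₁]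
    congr 1
    simp [SimpleGraph.compl_adj]
  · simp [nbhdMatrix, SimpleGraph.compl_adj]
  · simp [nbhdMatrix, SimpleGraph.compl_adj]
  · simp [nbhdMatrix, SimpleGraph.compl_adj, Matrix.one_apply]

theorem det_nbhdMatrix_compl_sum_top (G : SimpleGraph V) :
    (nbhdMatrix (G ⊕g (⊤ : SimpleGraph W))ᶜ).det =
      (nbhdMatrix Gᶜ - Matrix.of fun _ _ => (Fintype.card W : ZMod 2)).det := by
  rw [nbhdMatrix_compl_sum_top, Matrix.det_fromBlocks_one₂₂]
  congr 2
  ext i j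
  simp [Matrix.mul_apply]

/-- Adding an isolated edge to a graph does not affect solvability on the complement. -/
theorem universallySolvable_compl_sum_top_two (G : SimpleGraph V) :
    UniversallySolvable (G ⊕g (⊤ : SimpleGraph (Fin 2)))ᶜ ↔ UniversallySolvable Gᶜ := by
  rw [universallySolvable_iff_det_ne_zero, universallySolvable_iff_det_ne_zero,
    det_nbhdMatrix_compl_sum_top]
  have : (Matrix.of fun _ _ => (Fintype.card (Fin 2) : ZMod 2) : Matrix V V (ZMod 2)) = 0 := by
    ext i j
    simpa using (by decide : (2 : ZMod 2) = 0)
  rw [this, sub_zero]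

/-- Lights Out is solvable on the complement of a graph with an isolated vertex iff the rest of
the graph has even order and solvable complement. -/
theorem universallySolvable_compl_sum_top_one (G : SimpleGraph V) :
    UniversallySolvable (G ⊕g (⊤ : SimpleGraph (Fin 1)))ᶜ ↔
      Even (Fintype.card V) ∧ UniversallySolvable Gᶜ := by
  classical
  rw [universallySolvable_iff_det_ne_zero, universallySolvable_iff_det_ne_zero,
    det_nbhdMatrix_compl_sum_top]
  have hadj : nbhdMatrix Gᶜ - Matrix.of (fun _ _ => (Fintype.card (Fin 1) : ZMod 2)) =
      G.adjMatrix (ZMod 2) := by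
    ext i j
    by_cases hij : i = j
    · simp [nbhdMatrix, hij]
    · by_cases h : G.Adj i j
      · simp [nbhdMatrix, hij, h]
      · simp [nbhdMatrix, hij, h]
  have hsymm := G.isSymm_adjMatrix (α := ZMod 2)
  rcases Nat.even_or_odd (Fintype.card V) with hV | hV
  · have hcompl : nbhdMatrix Gᶜ = G.adjMatrix (ZMod 2) - Matrix.of fun _ _ => 1 := by
      rw [← hadj]
      ext i j
      simp only [Matrix.sub_apply, Matrix.of_apply, Fintype.card_fin, Nat.cast_one, sub_sub]
      rw [CharTwo.add_self_eq_zero, sub_zero]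
    rw [hadj, hcompl, Matrix.det_sub_allOnes_of_isSymm _ hsymm (by simp) hV]
    simp [hV]
  · rw [hadj, Matrix.det_eq_zero_of_isSymm_of_odd_card _ hsymm (by simp) hV]
    simp [Nat.not_even_iff_odd.2 hV]

end Solvability

section CliqueComponents

variable {V V' W : Type}

theorem exists_inl_of_iso_sum_top {G : SimpleGraph V} {H : SimpleGraph V'}
    (φ : G ⊕g (⊤ : SimpleGraph W) ≃g H ⊕g (⊤ : SimpleGraph W)) (x : V) :
    ∃ y, φ (.inl x) = .inl y ∨ ∃ t, φ (.inl x) = .inr t ∧ φ (.inr t) = .inl y := by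
  rcases hx : φ (.inl x) with y | t
  · exact ⟨y, Or.inl rfl⟩
  · rcases ht : φ (.inr t) with y | t'
    · exact ⟨y, Or.inr ⟨t, rfl, ht⟩⟩
    · exfalso
      have hadj := φ.map_adj_iff (v := .inl x) (w := .inr t)
      rw [hx, ht, SimpleGraph.sum_adj_inr, SimpleGraph.top_adj] at hadj
      have htt : t = t' := by
        by_contra hne
        exact SimpleGraph.not_adj_sum_inl_inr _ _ (hadj.1 hne)
      subst htt
      exact Sum.inl_ne_inr (φ.injective (hx.trans ht.symm))

/-- Clique components of equal size can be cancelled from isomorphic graphs. -/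
theorem SimpleGraph.Iso.nonempty_of_sum_top {G : SimpleGraph V} {H : SimpleGraph V'}
    (φ : G ⊕g (⊤ : SimpleGraph W) ≃g H ⊕g (⊤ : SimpleGraph W)) : Nonempty (G ≃g H) := by
  choose g hg using exists_inl_of_iso_sum_top φ
  choose h hh using exists_inl_of_iso_sum_top φ.symm
  have hleft : Function.LeftInverse h g := by
    intro x
    rcases hg x with hx | ⟨t, hx, ht⟩
    · have hx' : φ.symm (.inl (g x)) = .inl x := by rw [← hx, φ.symm_apply_apply]
      rcases hh (g x) with hy | ⟨s, hy, hs⟩ <;> simp_all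
    · have ht' : φ.symm (.inl (g x)) = .inr t := by rw [← ht, φ.symm_apply_apply]
      have hx' : φ.symm (.inr t) = .inl x := by rw [← hx, φ.symm_apply_apply]
      rcases hh (g x) with hy | ⟨s, hy, hs⟩
      · exact absurd (ht'.symm.trans hy) Sum.inr_ne_inl
      · obtain rfl : t = s := Sum.inr_injective (ht'.symm.trans hy)
        exact Sum.inl_injective (hs.symm.trans hx')
  have hright : Function.RightInverse h g := by
    intro y
    rcases hh y with hy | ⟨t, hy, ht⟩
    · have hy' : φ (.inl (h y)) = .inl y := by rw [← hy, φ.apply_symm_apply]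
      rcases hg (h y) with hx | ⟨s, hx, hs⟩ <;> simp_all
    · have ht' : φ (.inl (h y)) = .inr t := by rw [← ht, φ.apply_symm_apply]
      have hy' : φ (.inr t) = .inl y := by rw [← hy, φ.apply_symm_apply]
      rcases hg (h y) with hx | ⟨s, hx, hs⟩
      · exact absurd (ht'.symm.trans hx) Sum.inr_ne_inl
      · obtain rfl : t = s := Sum.inr_injective (ht'.symm.trans hx)
        exact Sum.inl_injective (hs.symm.trans hy')
  refine ⟨⟨⟨g, h, hleft, hright⟩, ?_⟩⟩
  intro x x'
  have h₁ := φ.map_adj_iff (v := .inl x) (w := .inl x')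
  rcases hg x with hx | ⟨t, hx, ht⟩ <;> rcases hg x' with hx' | ⟨t', hx', ht'⟩
  · simpa [hx, hx'] using h₁
  · have h₂ := φ.map_adj_iff (v := .inl x) (w := .inr t')
    simp_all
  · have h₂ := φ.map_adj_iff (v := .inr t) (w := .inl x')
    simp_all
  · have h₂ := φ.map_adj_iff (v := .inr t) (w := .inr t')
    simp_all

/-- The disjoint union of a graph with a clique on `k` vertices. -/
def addClique {n : ℕ} (k : ℕ) (G : SimpleGraph (Fin n)) : SimpleGraph (Fin (n + k)) :=
  (G ⊕g (⊤ : SimpleGraph (Fin k))).map finSumFinEquiv.toEmbedding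

/-- `addClique` is a disjoint union with a complete graph. -/
def addCliqueIso {n : ℕ} (k : ℕ) (G : SimpleGraph (Fin n)) :
    G ⊕g (⊤ : SimpleGraph (Fin k)) ≃g addClique k G :=
  SimpleGraph.Iso.map finSumFinEquiv _

theorem nonempty_iso_iff_addClique {n : ℕ} (k : ℕ) (G H : SimpleGraph (Fin n)) :
    Nonempty (G ≃g H) ↔ Nonempty (addClique k G ≃g addClique k H) := by
  constructor
  · rintro ⟨e⟩
    exact ⟨(addCliqueIso k G).symm.trans
      ((SimpleGraph.Iso.sumCongr e SimpleGraph.Iso.refl).trans (addCliqueIso k H))⟩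
  · rintro ⟨e⟩
    exact SimpleGraph.Iso.nonempty_of_sum_top
      ((addCliqueIso k G).trans (e.trans (addCliqueIso k H).symm))

/-- A graph with a clique component on `k` vertices arises by adding that clique. -/
theorem exists_addClique_iso {n k : ℕ} (K : SimpleGraph (Fin (n + k))) (c : Fin k ↪ Fin (n + k))
    (hc : ∀ i w, K.Adj (c i) w ↔ ∃ j, j ≠ i ∧ w = c j) :
    ∃ G : SimpleGraph (Fin n), Nonempty (addClique k G ≃g K) := by
  classical
  have hcard : Fintype.card (Fin n) = Fintype.card ((Set.range c)ᶜ : Set (Fin (n + k))) := by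
    rw [Fintype.card_compl_set, Set.card_range_of_injective c.injective]
    simp
  let e : Fin n ≃ ((Set.range c)ᶜ : Set (Fin (n + k))) := Fintype.equivOfCardEq hcard
  let E : Fin n ⊕ Fin k ≃ Fin (n + k) :=
    ((e.sumCongr (Equiv.ofInjective c c.injective)).trans (Equiv.sumComm _ _)).trans
      (Equiv.Set.sumCompl (Set.range c))
  have hEl : ∀ x, E (.inl x) = e x := fun x => rfl
  have hEr : ∀ i, E (.inr i) = c i := fun i => rfl
  have hmixed : ∀ x i, ¬ K.Adj (c i) (e x) := by
    intro x i h
    obtain ⟨j, -, hj⟩ := (hc i _).1 h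
    exact (e x).2 ⟨j, hj.symm⟩
  refine ⟨K.comap fun x => (e x : Fin (n + k)), ⟨(addCliqueIso k _).symm.trans ⟨E, ?_⟩⟩⟩
  rintro (x | i) (y | j)
  · simp [hEl]
  · simp [hEl, hEr, K.adj_comm _ (c j), hmixed]
  · simp [hEl, hEr, hmixed]
  · simp only [hEr, hc, SimpleGraph.sum_adj_inr, SimpleGraph.top_adj]
    constructor
    · rintro ⟨l, hl, h⟩
      rw [c.injective h]
      exact hl.symm
    · exact fun h => ⟨j, h.symm, rfl⟩

end CliqueComponents

section ExcessDegree

/-- The number of isolated vertices of a graph. -/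
noncomputable def numIsolated {V : Type} (G : SimpleGraph V) : ℕ :=
  {v : V | ∀ w, ¬ G.Adj v w}.ncard

theorem excessDegree_eq_edges {n : ℕ} (G : SimpleGraph (Fin n)) :
    excessDegree G = numIsolated G - n + 2 * (G.edgeSet.ncard : ℤ) := by
  classical
  have hdeg : ∀ v, (G.neighborSet v).ncard = G.degree v := by
    intro v
    rw [Set.ncard_eq_toFinset_card', ← SimpleGraph.card_neighborFinset_eq_degree]
    rfl
  have hedge : G.edgeSet.ncard = G.edgeFinset.card := by
    rw [Set.ncard_eq_toFinset_card']
    rfl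
  have hsum := G.sum_degrees_eq_twice_card_edges
  simp only [excessDegree, hdeg, hedge, numIsolated]
  rw [← Nat.cast_sum, hsum]
  push_cast
  rfl

/-- The sum of the amounts by which vertex degrees exceed one. -/
noncomputable def degreeExcess {V : Type} [Fintype V] (G : SimpleGraph V) : ℕ :=
  ∑ v, ((G.neighborSet v).ncard - 1)

theorem ncard_neighborSet_eq_zero_iff {V : Type} [Finite V] (G : SimpleGraph V) (v : V) :
    (G.neighborSet v).ncard = 0 ↔ ∀ w, ¬ G.Adj v w := by
  rw [Set.ncard_eq_zero (Set.toFinite _), Set.eq_empty_iff_forall_notMem]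
  rfl

theorem excessDegree_eq_degreeExcess {n : ℕ} (G : SimpleGraph (Fin n)) :
    excessDegree G = degreeExcess G := by
  classical
  have hiso : (({v : Fin n | ∀ w, ¬ G.Adj v w} : Set (Fin n)).ncard : ℤ) =
      ∑ v : Fin n, if (G.neighborSet v).ncard = 0 then 1 else 0 := by
    simp [Set.ncard_eq_toFinset_card']
  have hn : (n : ℤ) = ∑ _v : Fin n, 1 := by simp
  rw [excessDegree, hiso, degreeExcess]
  nth_rewrite 1 [hn]
  rw [← Finset.sum_sub_distrib, ← Finset.sum_add_distrib, Nat.cast_sum]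
  refine Finset.sum_congr rfl fun v _ => ?_
  split_ifs with h
  · simp [h]
  · push_cast [Nat.one_le_iff_ne_zero.2 h]
    ring

theorem SimpleGraph.Iso.degreeExcess_eq {V W : Type} [Fintype V] [Fintype W]
    {G : SimpleGraph V} {H : SimpleGraph W} (e : G ≃g H) : degreeExcess G = degreeExcess H := by
  rw [degreeExcess, degreeExcess, ← Equiv.sum_comp e.toEquiv]
  refine Finset.sum_congr rfl fun v _ => ?_
  rw [← Nat.card_coe_set_eq, ← Nat.card_coe_set_eq, Nat.card_congr (e.mapNeighborSet v)]
  rfl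

theorem SimpleGraph.Iso.excessDegree_eq {n : ℕ} {G H : SimpleGraph (Fin n)} (e : G ≃g H) :
    excessDegree G = excessDegree H := by
  rw [excessDegree_eq_degreeExcess, excessDegree_eq_degreeExcess, e.degreeExcess_eq]

theorem degreeExcess_sum_top {V W : Type} [Fintype V] [Fintype W] (G : SimpleGraph V)
    (hW : Fintype.card W ≤ 2) :
    degreeExcess (G ⊕g (⊤ : SimpleGraph W)) = degreeExcess G := by
  have hl : ∀ v, ((G ⊕g (⊤ : SimpleGraph W)).neighborSet (.inl v)).ncard =
      (G.neighborSet v).ncard := by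
    intro v
    rw [← Set.ncard_image_of_injective (G.neighborSet v) (Sum.inl_injective (β := W))]
    congr 1
    ext (w | w) <;> simp
  have hr : ∀ v, ((G ⊕g (⊤ : SimpleGraph W)).neighborSet (.inr v)).ncard - 1 = 0 := by
    intro v
    have himage : (G ⊕g (⊤ : SimpleGraph W)).neighborSet (.inr v) = Sum.inr '' {v}ᶜ := by
      ext (w | w) <;> simp [eq_comm]
    rw [himage, Set.ncard_image_of_injective _ Sum.inr_injective, Set.ncard_compl,
      Set.ncard_singleton, Nat.card_eq_fintype_card]
    omega
  simp [degreeExcess, hl, hr]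

theorem excessDegree_addClique {n k : ℕ} (hk : k ≤ 2) (G : SimpleGraph (Fin n)) :
    excessDegree (addClique k G) = excessDegree G := by
  rw [excessDegree_eq_degreeExcess, excessDegree_eq_degreeExcess,
    ← SimpleGraph.Iso.degreeExcess_eq (addCliqueIso k G), degreeExcess_sum_top G (by simpa using hk)]

/-- A graph whose non-isolated vertices number more than three times its excess degree has an
isolated edge. -/
theorem exists_isolated_edge {V : Type} [Fintype V] (G : SimpleGraph V)
    (h : 3 * degreeExcess G + numIsolated G < Fintype.card V) :
    ∃ a b, G.neighborSet a = {b} ∧ G.neighborSet b = {a} := by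
  classical
  by_contra hno
  let big : Finset V := {v | 2 ≤ (G.neighborSet v).ncard}
  have hcover : (Finset.univ : Finset V) ⊆ ({v : V | ∀ w, ¬ G.Adj v w} : Set V).toFinset ∪
      big.biUnion fun b => insert b (G.neighborSet b).toFinset := by
    intro v _
    rcases Nat.lt_or_ge (G.neighborSet v).ncard 2 with hv | hv
    · rcases Nat.lt_or_ge (G.neighborSet v).ncard 1 with hv' | hv'
      · apply Finset.mem_union_left
        simpa using (ncard_neighborSet_eq_zero_iff G v).1 (by omega)
      · apply Finset.mem_union_right
        obtain ⟨b, hb⟩ := Set.ncard_eq_one.1 (show (G.neighborSet v).ncard = 1 by omega)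
        have hvb : G.Adj v b := by
          rw [← SimpleGraph.mem_neighborSet, hb]
          rfl
        refine Finset.mem_biUnion.2 ⟨b, ?_, by simp [hvb.symm]⟩
        simp only [big, Finset.mem_filter, Finset.mem_univ, true_and]
        by_contra hlt
        have hone : (G.neighborSet b).ncard ≤ 1 := by omega
        refine hno ⟨v, b, hb, ?_⟩
        exact Set.Subset.antisymm
          (fun w hw => (Set.ncard_le_one (Set.toFinite _)).1 hone w hw v hvb.symm)
          (Set.singleton_subset_iff.2 hvb.symm)
    · exact Finset.mem_union_right _ (Finset.mem_biUnion.2 ⟨v, by simpa [big] using hv, by simp⟩)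
  have hcard := (Finset.card_le_card hcover).trans (Finset.card_union_le _ _)
  have hbig : (big.biUnion fun b => insert b (G.neighborSet b).toFinset).card ≤
      3 * degreeExcess G := by
    refine Finset.card_biUnion_le.trans ?_
    rw [degreeExcess, Finset.mul_sum]
    refine le_trans (Finset.sum_le_sum fun b hb => ?_)
      (Finset.sum_le_sum_of_subset (Finset.subset_univ big))
    have hb2 : 2 ≤ (G.neighborSet b).ncard := by simpa [big] using hb
    refine (Finset.card_insert_le _ _).trans ?_
    rw [← Set.ncard_eq_toFinset_card']
    omega
  rw [Finset.card_univ, ← Set.ncard_eq_toFinset_card'] at hcard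
  rw [numIsolated] at h
  omega

/-- If Lights Out is solvable on the complement of a graph, the graph has at most one isolated
vertex. -/
theorem numIsolated_le_one {V : Type} [Fintype V] [DecidableEq V] (G : SimpleGraph V)
    (hG : UniversallySolvable Gᶜ) : numIsolated G ≤ 1 := by
  rw [numIsolated, Set.ncard_le_one (Set.toFinite _)]
  intro a ha b hb
  by_contra hab
  refine (universallySolvable_iff_det_ne_zero _).1 hG (Matrix.det_zero_of_row_eq hab ?_)
  have hrow : ∀ c, (∀ w, ¬ G.Adj c w) → ∀ j, nbhdMatrix Gᶜ c j = 1 := by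
    intro c hc j
    simp [nbhdMatrix, SimpleGraph.compl_adj, hc, em]
  funext j
  rw [hrow a ha, hrow b hb]

end ExcessDegree

section Stability

theorem exists_addClique_one_iso {n : ℕ} (K : SimpleGraph (Fin (n + 1)))
    (hK : numIsolated K ≠ 0) : ∃ G : SimpleGraph (Fin n), Nonempty (addClique 1 G ≃g K) := by
  obtain ⟨a, ha⟩ := Set.nonempty_of_ncard_ne_zero hK
  refine exists_addClique_iso K ⟨fun _ => a, Function.injective_of_subsingleton _⟩ fun i w => ?_
  exact iff_of_false (ha w) fun ⟨j, hj, _⟩ => hj (Subsingleton.elim j i)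

theorem exists_addClique_two_iso {n : ℕ} (K : SimpleGraph (Fin (n + 2)))
    (hK : 3 * degreeExcess K + numIsolated K < n + 2) :
    ∃ G : SimpleGraph (Fin n), Nonempty (addClique 2 G ≃g K) := by
  obtain ⟨a, b, ha, hb⟩ := exists_isolated_edge K (by simpa using hK)
  simp only [Set.ext_iff, SimpleGraph.mem_neighborSet, Set.mem_singleton_iff] at ha hb
  have hab : a ≠ b := K.ne_of_adj ((ha b).2 rfl)
  have hinj : Function.Injective ![a, b] := by
    intro i j
    fin_cases i <;> fin_cases j <;> simp [hab, hab.symm]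
  refine exists_addClique_iso K ⟨![a, b], hinj⟩ fun i w => ?_
  fin_cases i <;> simp [Fin.exists_fin_two, ha, hb]

theorem universallySolvable_compl_addClique_two {n : ℕ} (G : SimpleGraph (Fin n)) :
    UniversallySolvable (addClique 2 G)ᶜ ↔ UniversallySolvable Gᶜ := by
  rw [← universallySolvable_compl_sum_top_two G]
  exact (addCliqueIso 2 G).complement.symm.universallySolvable_iff

theorem universallySolvable_compl_addClique_one {n : ℕ} (G : SimpleGraph (Fin n)) :
    UniversallySolvable (addClique 1 G)ᶜ ↔ Even n ∧ UniversallySolvable Gᶜ := by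
  have h := universallySolvable_compl_sum_top_one G
  rw [Fintype.card_fin] at h
  rw [← h]
  exact (addCliqueIso 1 G).complement.symm.universallySolvable_iff

/-- A graph of even order with solvable complement has no isolated vertex. -/
theorem numIsolated_eq_zero_of_even {n : ℕ} (hn : Even n) (K : SimpleGraph (Fin n))
    (hK : UniversallySolvable Kᶜ) : numIsolated K = 0 := by
  by_contra h
  obtain ⟨a, -⟩ := Set.nonempty_of_ncard_ne_zero h
  obtain ⟨k, rfl⟩ : ∃ k, n = k + 1 := ⟨n - 1, by have := a.2; omega⟩
  obtain ⟨G, ⟨e⟩⟩ := exists_addClique_one_iso K h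
  have hk := ((universallySolvable_compl_addClique_one G).1
    (e.complement.universallySolvable_iff.2 hK)).1
  rw [Nat.even_add_one] at hn
  exact hn hk

theorem excessDegree_solvable_of_iso {n : ℕ} {d : ℤ} (G H : SimpleGraph (Fin n))
    (h : Nonempty (G ≃g H)) (hG : excessDegree G = d ∧ UniversallySolvable Gᶜ) :
    excessDegree H = d ∧ UniversallySolvable Hᶜ := by
  obtain ⟨e⟩ := h
  exact ⟨e.excessDegree_eq ▸ hG.1, e.complement.universallySolvable_iff.1 hG.2⟩

theorem numExcess_add_two {n d : ℕ} (h : 3 * d + (n + d) % 2 < n + 2) :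
    numExcess (n + 2) d = numExcess n d := by
  refine (card_isoClasses_congr (addClique 2) (nonempty_iso_iff_addClique 2) (fun G => ?_)
    excessDegree_solvable_of_iso fun K hK => exists_addClique_two_iso K ?_).symm
  · rw [excessDegree_addClique le_rfl, universallySolvable_compl_addClique_two]
  · have hiso := numIsolated_le_one K hK.2
    have hedges := excessDegree_eq_edges K
    have hd := hK.1
    rw [hd] at hedges
    rw [excessDegree_eq_degreeExcess] at hd
    push_cast at hedges hd
    omega

theorem numExcess_add_two_mul {n d : ℕ} (h : 3 * d + (n + d) % 2 < n + 2) (j : ℕ) :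
    numExcess (n + 2 * j) d = numExcess n d := by
  induction j with
  | zero => rfl
  | succ j ih => rw [← ih, Nat.mul_succ, ← Nat.add_assoc, numExcess_add_two (by omega)]

theorem numExcess_add_one {n d : ℕ} (hn : Even n) (hd : Even d) :
    numExcess (n + 1) d = numExcess n d := by
  refine (card_isoClasses_congr (addClique 1) (nonempty_iso_iff_addClique 1) (fun G => ?_)
    excessDegree_solvable_of_iso fun K hK => exists_addClique_one_iso K ?_).symm
  · rw [excessDegree_addClique one_le_two, universallySolvable_compl_addClique_one]
    simp [hn]
  · have hedges := excessDegree_eq_edges K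
    rw [hK.1] at hedges
    rw [Nat.even_iff] at hn hd
    push_cast at hedges
    omega

theorem ncard_edgeSet_add_compl {n : ℕ} (G : SimpleGraph (Fin n)) :
    G.edgeSet.ncard + Gᶜ.edgeSet.ncard = n * (n - 1) / 2 := by
  classical
  have hdisj : Disjoint G.edgeSet Gᶜ.edgeSet :=
    SimpleGraph.disjoint_edgeSet.2 disjoint_compl_right
  have htop := SimpleGraph.card_edgeFinset_top_eq_card_choose_two (V := Fin n)
  rw [Fintype.card_fin, Nat.choose_two_right] at htop
  rw [← htop, ← Set.ncard_union_eq hdisj (Set.toFinite _) (Set.toFinite _),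
    ← SimpleGraph.edgeSet_sup, sup_compl_eq_top, Set.ncard_eq_toFinset_card']
  rfl

/-- Counting solvable graphs through the edges of their complements. -/
theorem numSolvableEdges_eq_compl {n m : ℕ} (hn : n / 2 + m ≤ n * (n - 1) / 2) :
    numSolvableEdges n m = Nat.card (Quotient (isoSetoid fun G : SimpleGraph (Fin n) =>
      G.edgeSet.ncard = n / 2 + m ∧ UniversallySolvable Gᶜ)) := by
  refine card_isoClasses_congr compl (fun G H => ⟨?_, ?_⟩) (fun G => ?_) ?_ fun K _ => ?_
  · rintro ⟨e⟩
    exact ⟨e.complement⟩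
  · rintro ⟨e⟩
    have e' := e.complement
    rw [compl_compl, compl_compl] at e'
    exact ⟨e'⟩
  · have := ncard_edgeSet_add_compl G
    rw [compl_compl]
    exact and_congr_left fun _ => by omega
  · rintro G H ⟨e⟩ ⟨hG, hS⟩
    refine ⟨?_, e.complement.universallySolvable_iff.1 hS⟩
    rw [← hG, ← Nat.card_coe_set_eq, ← Nat.card_coe_set_eq, Nat.card_congr e.mapEdgeSet]
  · exact ⟨Kᶜ, by rw [compl_compl]; exact ⟨SimpleGraph.Iso.refl⟩⟩

end Stability

/-- For a fixed positive integer `m` and `n ≥ 6m`: if `n` is even then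
`U^n_m = E^{6m}_{2m}`, and if `n` is odd then `U^n_m = E^{6m-3}_{2m-1} + E^{6m}_{2m}`. -/
theorem numSolvableEdges_eq (m : ℕ) (hm : 0 < m) (n : ℕ) (hn : 6 * m ≤ n) :
    (Even n → numSolvableEdges n m = numExcess (6 * m) (2 * m)) ∧
    (Odd n → numSolvableEdges n m =
      numExcess (6 * m - 3) (2 * m - 1) + numExcess (6 * m) (2 * m)) := by
  have hsize : n / 2 + m ≤ n * (n - 1) / 2 := by
    rw [Nat.le_div_iff_mul_le two_pos]
    have h5 : n * 5 ≤ n * (n - 1) := Nat.mul_le_mul_left n (by omega)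
    omega
  rw [numSolvableEdges_eq_compl hsize]
  constructor
  · intro hev
    obtain ⟨j, rfl⟩ : ∃ j, n = 6 * m + 2 * j := by
      obtain ⟨l, rfl⟩ := hev
      exact ⟨l - 3 * m, by omega⟩
    rw [← numExcess_add_two_mul (n := 6 * m) (by omega) j, numExcess]
    refine congrArg (fun P => Nat.card (Quotient (isoSetoid P))) (funext fun G => propext ?_)
    refine and_congr_left fun hG => ?_
    have hiso := numIsolated_eq_zero_of_even hev G hG
    have hedges := excessDegree_eq_edges G
    push_cast at hedges ⊢
    omega
  · intro hodd
    obtain ⟨j, rfl⟩ : ∃ j, n = 6 * m + 1 + 2 * j := by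
      obtain ⟨l, rfl⟩ := hodd
      exact ⟨l - 3 * m, by omega⟩
    rw [← numExcess_add_one (n := 6 * m) (d := 2 * m) ⟨3 * m, by ring⟩ ⟨m, by ring⟩,
      ← numExcess_add_two_mul (n := 6 * m + 1) (by omega) j,
      ← numExcess_add_two_mul (n := 6 * m - 3) (by omega) (j + 2),
      show 6 * m - 3 + 2 * (j + 2) = 6 * m + 1 + 2 * j by omega]
    refine card_isoClasses_of_iff_or (fun G => ?_) fun G H hG hH => ⟨fun e => ?_⟩
    · rw [← or_and_right]
      refine and_congr_left fun hG => ?_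
      have hiso := numIsolated_le_one G hG
      have hedges := excessDegree_eq_edges G
      push_cast [Nat.cast_sub (show 1 ≤ 2 * m by omega)] at hedges ⊢
      omega
    · have heq := e.excessDegree_eq
      rw [hG.1, hH.1] at heq
      omega
end

section
/- For every positive integer m there exists a positive integer M such that for all n > M and all integers e with N − ⌊n/2⌋ − m ≤ e ≤ N, where N = n(n−1)/2, the probability P_{n,e} is maximized when e = N − ⌊n/2⌋; that is, P_{n,e} ≤ P_{n, N − ⌊n/2⌋} for every such e. Here P_{n,e} is the probability that a graph chosen uniformly at random from the isomorphism classes of simple graphs with n vertices and e edges has invertible neighborhood matrix over 𝔽₂. -/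
/-- The number of isomorphism classes of simple graphs with `n` vertices and exactly `e`
edges on which Lights Out is universally solvable. -/
noncomputable def numSolvableGraphs (n e : ℕ) : ℕ :=
  Nat.card (Quotient (isoSetoid fun G : SimpleGraph (Fin n) =>
    G.edgeSet.ncard = e ∧ UniversallySolvable G))

/-- `G_{n,e}`: the number of isomorphism classes of simple graphs with `n` vertices and
exactly `e` edges. -/
noncomputable def numGraphs (n e : ℕ) : ℕ :=
  Nat.card (Quotient (isoSetoid fun G : SimpleGraph (Fin n) => G.edgeSet.ncard = e))

/-- `P_{n,e}`: the probability that a graph chosen uniformly at random from the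
isomorphism classes of simple graphs with `n` vertices and `e` edges has a universally
solvable game of Lights Out. -/
noncomputable def solvProb (n e : ℕ) : ℝ :=
  (numSolvableGraphs n e : ℝ) / (numGraphs n e : ℝ)

open scoped Classical in
/-- The `k`-element subsets invariant under the permutation `τ`. -/
noncomputable def invariantSets {X : Type} [Fintype X] (τ : Equiv.Perm X) (k : ℕ) :
    Finset (Finset X) :=
  Finset.univ.filter fun S => S.card = k ∧ ∀ x, τ x ∈ S ↔ x ∈ S

open scoped Classical in
/-- The fixed points of the permutation `τ`, as a finset. -/
noncomputable def fixedFinset {X : Type} [Fintype X] (τ : Equiv.Perm X) : Finset X :=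
  Finset.univ.filter fun x => τ x = x

section InvariantSets

variable {X : Type} [Fintype X] (τ : Equiv.Perm X)

open scoped Classical in
lemma card_invariantSets_step (k : ℕ) :
    (invariantSets τ k).card * ((fixedFinset τ).card - k) ≤
      (invariantSets τ (k + 1)).card * (k + 1) := by
  refine Finset.card_mul_le_card_mul (fun S T => ∃ x, x ∉ S ∧ insert x S = T) ?_ ?_
  · intro S hS
    simp only [invariantSets, Finset.mem_filter, Finset.mem_univ, true_and] at hS
    obtain ⟨hk, hinv⟩ := hS
    calc (fixedFinset τ).card - k ≤ (fixedFinset τ \ S).card := by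
          rw [← hk]; exact Finset.le_card_sdiff _ _
      _ = ((fixedFinset τ \ S).image fun x => insert x S).card := by
          refine (Finset.card_image_of_injOn ?_).symm
          intro x hx y hy hxy
          simp only [Finset.coe_sdiff, Set.mem_sdiff, Finset.mem_coe] at hx hy
          have : x ∈ insert y S := by
            rw [← show insert x S = insert y S from hxy]; exact Finset.mem_insert_self _ _
          rcases Finset.mem_insert.1 this with h | h
          · exact h
          · exact absurd h hx.2
      _ ≤ _ := by
          refine Finset.card_le_card ?_
          intro T hT
          simp only [Finset.mem_image, Finset.mem_sdiff] at hT
          obtain ⟨x, ⟨hxf, hxS⟩, rfl⟩ := hT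
          simp only [fixedFinset, Finset.mem_filter, Finset.mem_univ, true_and] at hxf
          simp only [Finset.mem_bipartiteAbove, invariantSets, Finset.mem_filter,
            Finset.mem_univ, true_and]
          refine ⟨⟨by rw [Finset.card_insert_of_notMem hxS, hk], fun y => ?_⟩, x, hxS, rfl⟩
          rw [Finset.mem_insert, Finset.mem_insert, hinv]
          nth_rewrite 1 [← hxf]
          rw [τ.injective.eq_iff]
  · intro T hT
    simp only [invariantSets, Finset.mem_filter, Finset.mem_univ, true_and] at hT
    calc _ ≤ (T.image fun x => T.erase x).card := by
          refine Finset.card_le_card ?_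
          intro S hS
          simp only [Finset.mem_bipartiteBelow] at hS
          obtain ⟨-, x, hxS, rfl⟩ := hS
          exact Finset.mem_image.2 ⟨x, Finset.mem_insert_self _ _, Finset.erase_insert hxS⟩
      _ ≤ T.card := Finset.card_image_le
      _ = k + 1 := hT.1

lemma card_invariantSets_add {k C n : ℕ} (hfix : (2 * C + 1) * (n + 1) ≤ (fixedFinset τ).card)
    (j : ℕ) (hj : 0 < j) (hC : 0 < C) (hn : k + j ≤ n + 1) :
    2 * C * (invariantSets τ k).card ≤ (invariantSets τ (k + j)).card := by
  have step : ∀ i, i ≤ n → 2 * C * (invariantSets τ i).card ≤ (invariantSets τ (i + 1)).card := by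
    intro i hi
    have h := card_invariantSets_step τ i
    have h2 : 2 * C * (i + 1) ≤ (fixedFinset τ).card - i := by
      have : 2 * C * (i + 1) + i ≤ (2 * C + 1) * (n + 1) := by nlinarith
      omega
    refine Nat.le_of_mul_le_mul_right ?_ (Nat.succ_pos i)
    calc 2 * C * (invariantSets τ i).card * (i + 1)
        = (invariantSets τ i).card * (2 * C * (i + 1)) := by ring
      _ ≤ _ := Nat.mul_le_mul_left _ h2
      _ ≤ _ := h
  obtain ⟨j, rfl⟩ : ∃ l, j = l + 1 := ⟨j - 1, by omega⟩
  clear hj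
  induction j with
  | zero => exact step k (by omega)
  | succ j ih =>
    have h1 := ih (by omega)
    have h2 := step (k + (j + 1)) (by omega)
    have h3 : (invariantSets τ (k + (j + 1))).card ≤
        2 * C * (invariantSets τ (k + (j + 1))).card := Nat.le_mul_of_pos_left _ (by omega)
    exact h1.trans (h3.trans h2)

lemma mem_iff_of_sameCycle {S : Finset X} (hS : ∀ x, τ x ∈ S ↔ x ∈ S) {x y : X}
    (h : τ.SameCycle x y) : x ∈ S ↔ y ∈ S := by
  obtain ⟨i, -, rfl⟩ := h.exists_pow_eq'
  clear h
  induction i with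
  | zero => simp
  | succ i ih => rw [pow_succ', Equiv.Perm.mul_apply, hS]; exact ih

/-- A bound for the number of subsets with at most `s` elements, obtained by weighting each
subset `R` by `n ^ (s - |R|)`. -/
lemma card_small_subsets_le {Y : Type} [Fintype Y] {n s L : ℕ} (hn : 0 < n)
    (hY : Fintype.card Y ≤ n * L) :
    ((Finset.univ.filter fun R : Finset Y => R.card ≤ s).card : ℝ) ≤ 3 ^ L * n ^ s := by
  have hn' : (0 : ℝ) < n := by exact_mod_cast hn
  have hn1 : (1 : ℝ) ≤ n := by exact_mod_cast hn
  calc ((Finset.univ.filter fun R : Finset Y => R.card ≤ s).card : ℝ)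
      = ∑ R ∈ Finset.univ.filter (fun R : Finset Y => R.card ≤ s), (1 : ℝ) := by simp
    _ ≤ ∑ R ∈ Finset.univ.filter (fun R : Finset Y => R.card ≤ s),
          (n : ℝ) ^ s * (1 / (n : ℝ)) ^ R.card := by
        refine Finset.sum_le_sum fun R hR => ?_
        have hR := (Finset.mem_filter.1 hR).2
        rw [one_div, inv_pow, ← div_eq_mul_inv, one_le_div (by positivity)]
        exact pow_le_pow_right₀ hn1 hR
    _ ≤ ∑ R : Finset Y, (n : ℝ) ^ s * (1 / (n : ℝ)) ^ R.card :=
        Finset.sum_le_sum_of_subset_of_nonneg (Finset.filter_subset _ _)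
          fun _ _ _ => by positivity
    _ = (n : ℝ) ^ s * (1 / (n : ℝ) + 1) ^ Fintype.card Y := by
        rw [← Finset.mul_sum]
        have := Fintype.sum_pow_mul_eq_add_pow Y (1 / (n : ℝ)) 1
        simp only [one_pow, mul_one] at this
        rw [this]
    _ ≤ (n : ℝ) ^ s * (1 / (n : ℝ) + 1) ^ (n * L) := by
        gcongr
        · have : 0 < 1 / (n : ℝ) := by positivity
          linarith
    _ ≤ (n : ℝ) ^ s * 3 ^ L := by
        gcongr
        rw [pow_mul]
        gcongr
        calc (1 / (n : ℝ) + 1) ^ n ≤ (Real.exp (1 / n)) ^ n := by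
              gcongr; exact Real.add_one_le_exp _
          _ = Real.exp 1 := by rw [← Real.exp_nat_mul]; congr 1; field_simp
          _ ≤ 3 := Real.exp_one_lt_three.le
    _ = _ := by ring

open scoped Classical in
lemma card_invariantSets_le {n k L : ℕ} (hn : 0 < n) (hX : Fintype.card X ≤ n * L) :
    ((invariantSets τ k).card : ℝ) ≤ 2 ^ (fixedFinset τ).card * (3 ^ L * n ^ (k / 2)) := by
  let π : X → Quotient (Equiv.Perm.SameCycle.setoid τ) := Quotient.mk _
  have hπ : ∀ x y, π x = π y ↔ τ.SameCycle x y := fun x y => Quotient.eq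
  have hY : Fintype.card (Quotient (Equiv.Perm.SameCycle.setoid τ)) ≤ n * L :=
    (Fintype.card_quotient_le _).trans hX
  have key : (invariantSets τ k).card ≤ ((fixedFinset τ).powerset ×ˢ
      (Finset.univ.filter fun R : Finset (Quotient (Equiv.Perm.SameCycle.setoid τ)) =>
        R.card ≤ k / 2)).card := by
    refine Finset.card_le_card_of_injOn
      (fun S => (S ∩ fixedFinset τ, (S \ fixedFinset τ).image π)) ?_ ?_
    · intro S hS
      simp only [invariantSets, Finset.coe_filter, Finset.mem_univ, true_and,
        Set.mem_ofPred_eq] at hS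
      simp only [Finset.coe_product, Set.mem_prod, Finset.mem_coe, Finset.mem_powerset,
        Finset.mem_filter, Finset.mem_univ, true_and]
      refine ⟨Finset.inter_subset_right, ?_⟩
      rw [Nat.le_div_iff_mul_le two_pos]
      calc ((S \ fixedFinset τ).image π).card * 2 = 2 * ((S \ fixedFinset τ).image π).card :=
            mul_comm _ _
        _ ≤ (S \ fixedFinset τ).card := by
            refine Finset.mul_card_image_le_card _ _ ?_
            intro y hy
            obtain ⟨x, hx, rfl⟩ := Finset.mem_image.1 hy
            simp only [Finset.mem_sdiff, fixedFinset, Finset.mem_filter, Finset.mem_univ,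
              true_and] at hx
            rw [← Finset.card_pair (Ne.symm hx.2)]
            refine Finset.card_le_card ?_
            intro z hz
            rw [Finset.mem_insert, Finset.mem_singleton] at hz
            simp only [Finset.mem_filter, Finset.mem_sdiff, fixedFinset, Finset.mem_univ, true_and]
            rcases hz with rfl | rfl
            · exact ⟨hx, rfl⟩
            · refine ⟨⟨(hS.2 x).2 hx.1, fun h => hx.2 (τ.injective h)⟩, ?_⟩
              rw [hπ]
              exact (Equiv.Perm.sameCycle_apply_left).2 (Equiv.Perm.SameCycle.refl _ _)
        _ ≤ S.card := Finset.card_le_card Finset.sdiff_subset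
        _ = k := hS.1
    · intro S hS T hT hST
      simp only [invariantSets, Finset.coe_filter, Finset.mem_univ, true_and,
        Set.mem_ofPred_eq] at hS hT
      simp only [Prod.mk.injEq] at hST
      have aux : ∀ {S T : Finset X}, (∀ x, τ x ∈ T ↔ x ∈ T) →
          S ∩ fixedFinset τ = T ∩ fixedFinset τ →
          (S \ fixedFinset τ).image π = (T \ fixedFinset τ).image π → S ⊆ T := by
        intro S T hT h1 h2 x hx
        by_cases hf : x ∈ fixedFinset τ
        · exact (Finset.mem_inter.1 (h1 ▸ Finset.mem_inter.2 ⟨hx, hf⟩)).1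
        · have : π x ∈ (T \ fixedFinset τ).image π :=
            h2 ▸ Finset.mem_image_of_mem π (Finset.mem_sdiff.2 ⟨hx, hf⟩)
          obtain ⟨y, hy, hyx⟩ := Finset.mem_image.1 this
          exact (mem_iff_of_sameCycle τ hT ((hπ _ _).1 hyx)).1 (Finset.mem_sdiff.1 hy).1
      exact (aux hT.2 hST.1 hST.2).antisymm (aux hS.2 hST.1.symm hST.2.symm)
  rw [Finset.card_product, Finset.card_powerset] at key
  refine (Nat.cast_le.2 key).trans ?_
  push_cast
  gcongr
  exact card_small_subsets_le hn hY

end InvariantSets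

/-- The unordered pairs of distinct vertices, i.e. the potential edges. -/
abbrev Pairs (V : Type) : Type := {e : Sym2 V // ¬ e.IsDiag}

open scoped Classical in
/-- The finset of edges of a graph, as potential edges. -/
noncomputable def edgePairs {V : Type} [Fintype V] (G : SimpleGraph V) : Finset (Pairs V) :=
  Finset.univ.filter fun e => e.1 ∈ G.edgeSet

section EdgePairs

variable {V : Type} [Fintype V]

lemma mem_edgePairs {G : SimpleGraph V} {e : Pairs V} : e ∈ edgePairs G ↔ e.1 ∈ G.edgeSet := by
  simp [edgePairs]

lemma card_edgePairs (G : SimpleGraph V) : (edgePairs G).card = G.edgeSet.ncard := by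
  classical
  rw [← Set.ncard_coe_finset, ← Set.ncard_image_of_injective _ Subtype.val_injective]
  congr 1
  ext e
  simp only [Set.mem_image, Finset.mem_coe, mem_edgePairs]
  constructor
  · rintro ⟨x, hx, rfl⟩; exact hx
  · intro h; exact ⟨⟨e, G.not_isDiag_of_mem_edgeSet h⟩, h, rfl⟩

/-- A graph is the same as a finset of potential edges. -/
noncomputable def edgePairsEquiv (V : Type) [Fintype V] : SimpleGraph V ≃ Finset (Pairs V) where
  toFun := edgePairs
  invFun S := SimpleGraph.fromEdgeSet (Subtype.val '' (S : Set (Pairs V)))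
  left_inv G := by
    ext a b
    simp only [SimpleGraph.fromEdgeSet_adj, Set.mem_image, Finset.mem_coe, mem_edgePairs]
    constructor
    · rintro ⟨⟨x, hx, h⟩, -⟩
      rwa [h] at hx
    · intro h
      exact ⟨⟨⟨s(a, b), by simpa using h.ne⟩, h, rfl⟩, h.ne⟩
  right_inv S := by
    ext ⟨e, he⟩
    simp only [mem_edgePairs, SimpleGraph.edgeSet_fromEdgeSet]
    constructor
    · rintro ⟨⟨x, hx, rfl⟩, -⟩; exact hx
    · intro h
      exact ⟨⟨_, h, rfl⟩, he⟩

lemma edgePairs_compl [DecidableEq V] (G : SimpleGraph V) :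
    edgePairs Gᶜ = (edgePairs G)ᶜ := by
  ext ⟨e, he⟩
  induction e with
  | _ a b =>
    simp only [mem_edgePairs, Finset.mem_compl, SimpleGraph.mem_edgeSet, SimpleGraph.compl_adj]
    simp only [Sym2.mk_isDiag_iff] at he
    simp [he]

lemma card_pairs (n : ℕ) : Fintype.card (Pairs (Fin n)) = n.choose 2 := by
  classical
  have := Sym2.card_subtype_not_diag (α := Fin n)
  rw [Fintype.card_fin] at this
  rw [← this]

lemma ncard_edgeSet_compl {n : ℕ} (G : SimpleGraph (Fin n)) :
    Gᶜ.edgeSet.ncard = n.choose 2 - G.edgeSet.ncard := by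
  rw [← card_edgePairs, ← card_edgePairs, edgePairs_compl, Finset.card_compl, card_pairs]

/-- The permutation of potential edges induced by a permutation of vertices. -/
def pairPerm (σ : Equiv.Perm V) : Equiv.Perm (Pairs V) where
  toFun e := ⟨e.1.map σ, fun h => e.2 ((Sym2.isDiag_map σ.injective).1 h)⟩
  invFun e := ⟨e.1.map σ.symm, fun h => e.2 ((Sym2.isDiag_map σ.symm.injective).1 h)⟩
  left_inv e := Subtype.ext (by simp [Sym2.map_map])
  right_inv e := Subtype.ext (by simp [Sym2.map_map])

end EdgePairs

lemma ncard_edgeSet_congr {V W : Type} {G : SimpleGraph V} {H : SimpleGraph W} (f : G ≃g H) :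
    G.edgeSet.ncard = H.edgeSet.ncard :=
  Nat.card_congr f.mapEdgeSet

/-- Permutations of the vertices act on graphs with a given number of edges. -/
instance graphAction (n k : ℕ) :
    MulAction (Equiv.Perm (Fin n)) {G : SimpleGraph (Fin n) // G.edgeSet.ncard = k} where
  smul σ G := ⟨G.1.comap (σ⁻¹ : Equiv.Perm (Fin n)),
    (ncard_edgeSet_congr (SimpleGraph.Iso.comap (σ⁻¹ : Equiv.Perm (Fin n)) G.1)).trans G.2⟩
  one_smul _ := rfl
  mul_smul _ _ _ := Subtype.ext <| by
    ext a b
    exact Iff.rfl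

lemma smul_graph_adj {n k : ℕ} (σ : Equiv.Perm (Fin n))
    (G : {G : SimpleGraph (Fin n) // G.edgeSet.ncard = k}) (a b : Fin n) :
    (σ • G).1.Adj a b ↔ G.1.Adj (σ⁻¹ a) (σ⁻¹ b) := Iff.rfl

lemma isoSetoid_eq_orbitRel (n k : ℕ) :
    (isoSetoid fun G : SimpleGraph (Fin n) => G.edgeSet.ncard = k) =
      MulAction.orbitRel (Equiv.Perm (Fin n)) _ := by
  ext G H
  rw [MulAction.orbitRel_apply, MulAction.mem_orbit_iff]
  constructor
  · rintro ⟨f⟩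
    refine ⟨f.toEquiv.symm, Subtype.ext ?_⟩
    ext a b
    exact f.map_rel_iff
  · rintro ⟨σ, rfl⟩
    exact ⟨SimpleGraph.Iso.comap (σ⁻¹ : Equiv.Perm (Fin n)) H.1⟩

lemma smul_graph_eq_iff {n k : ℕ} (σ : Equiv.Perm (Fin n))
    (G : {G : SimpleGraph (Fin n) // G.edgeSet.ncard = k}) :
    σ • G = G ↔ ∀ e, pairPerm σ e ∈ edgePairs G.1 ↔ e ∈ edgePairs G.1 := by
  have h1 : σ • G = G ↔ ∀ a b, G.1.Adj (σ a) (σ b) ↔ G.1.Adj a b := by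
    rw [Subtype.ext_iff, SimpleGraph.ext_iff, funext_iff]
    simp only [funext_iff, eq_iff_iff, smul_graph_adj]
    constructor
    · intro h a b
      simpa using (h (σ a) (σ b)).symm
    · intro h a b
      simpa using (h (σ⁻¹ a) (σ⁻¹ b)).symm
  rw [h1]
  constructor
  · rintro h ⟨e, he⟩
    induction e with
    | _ a b =>
      simp only [mem_edgePairs]
      exact h a b
  · intro h a b
    by_cases hab : a = b
    · subst hab; simp
    · have := h ⟨s(a, b), by simpa using hab⟩
      simp only [mem_edgePairs] at this
      exact this

lemma card_fixedBy_graph {n : ℕ} (k : ℕ) (σ : Equiv.Perm (Fin n)) :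
    Nat.card (MulAction.fixedBy {G : SimpleGraph (Fin n) // G.edgeSet.ncard = k} σ) =
      (invariantSets (pairPerm σ) k).card := by
  rw [← Fintype.card_coe, ← Nat.card_eq_fintype_card]
  refine Nat.card_congr
    { toFun := fun G => ⟨edgePairs G.1.1, ?_⟩
      invFun := fun S => ⟨⟨(edgePairsEquiv (Fin n)).symm S.1, ?_⟩, ?_⟩
      left_inv := fun G => ?_
      right_inv := fun S => ?_ }
  · simp only [invariantSets, Finset.mem_filter, Finset.mem_univ, true_and]
    exact ⟨(card_edgePairs _).trans G.1.2, (smul_graph_eq_iff σ G.1).1 G.2⟩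
  · have hS := S.2
    simp only [invariantSets, Finset.mem_filter, Finset.mem_univ, true_and] at hS
    rw [← card_edgePairs]
    exact (congrArg Finset.card ((edgePairsEquiv (Fin n)).apply_symm_apply S.1)).trans hS.1
  · have hS := S.2
    simp only [invariantSets, Finset.mem_filter, Finset.mem_univ, true_and] at hS
    refine (smul_graph_eq_iff σ _).2 ?_
    rw [show edgePairs ((edgePairsEquiv (Fin n)).symm S.1) = S.1 from
      (edgePairsEquiv (Fin n)).apply_symm_apply S.1]
    exact hS.2
  · exact Subtype.ext (Subtype.ext ((edgePairsEquiv (Fin n)).symm_apply_apply G.1.1))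
  · exact Subtype.ext ((edgePairsEquiv (Fin n)).apply_symm_apply S.1)

lemma burnside_graphs (n k : ℕ) :
    ∑ σ : Equiv.Perm (Fin n), (invariantSets (pairPerm σ) k).card =
      numGraphs n k * n.factorial := by
  classical
  have h := MulAction.sum_card_fixedBy_eq_card_orbits_mul_card_group (Equiv.Perm (Fin n))
    {G : SimpleGraph (Fin n) // G.edgeSet.ncard = k}
  rw [Fintype.card_perm, Fintype.card_fin] at h
  rw [numGraphs, isoSetoid_eq_orbitRel, Nat.card_eq_fintype_card]
  refine Eq.trans (Finset.sum_congr rfl fun σ _ => ?_) h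
  rw [← card_fixedBy_graph, Nat.card_eq_fintype_card]

lemma ncard_edgeSet_map {V W : Type} (f : V ↪ W) (G : SimpleGraph V) :
    (G.map f).edgeSet.ncard = G.edgeSet.ncard := by
  rw [SimpleGraph.edgeSet_map]
  exact Set.ncard_image_of_injective _ f.sym2Map.injective

lemma card_graphs_with_edges (v k : ℕ) :
    Nat.card {H : SimpleGraph (Fin v) // H.edgeSet.ncard = k} = (v.choose 2).choose k := by
  rw [← card_pairs, ← Finset.card_univ, ← Finset.card_powersetCard, ← Fintype.card_coe,
    ← Nat.card_eq_fintype_card]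
  refine Nat.card_congr ((edgePairsEquiv (Fin v)).subtypeEquiv fun H => ?_)
  simp only [Finset.mem_powersetCard_univ]
  rw [← card_edgePairs]
  rfl

/-- If two graphs become isomorphic after adding isolated vertices, then the edges of one are the
images of the edges of the other under a self-map of the vertices. -/
lemma exists_map_of_iso_map {v n : ℕ} (ι : Fin v ↪ Fin n) {H K : SimpleGraph (Fin v)}
    (f : H.map ι ≃g K.map ι) :
    ∃ g : Fin v → Fin v, ∀ x y, K.Adj x y ↔ ∃ a b, H.Adj a b ∧ g a = x ∧ g b = y := by
  classical
  let g : Fin v → Fin v := fun a => if h : ∃ x, ι x = f (ι a) then h.choose else a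
  have hg : ∀ a x, ι x = f (ι a) → g a = x := by
    intro a x hx
    have h : ∃ x, ι x = f (ι a) := ⟨x, hx⟩
    have : g a = h.choose := dif_pos h
    rw [this]
    exact ι.injective (h.choose_spec.trans hx.symm)
  refine ⟨g, fun x y => ⟨fun hxy => ?_, ?_⟩⟩
  · have h1 : (K.map ι).Adj (ι x) (ι y) := (SimpleGraph.map_adj_apply).2 hxy
    have h2 : (H.map ι).Adj (f.symm (ι x)) (f.symm (ι y)) := f.symm.map_rel_iff.2 h1
    obtain ⟨a, b, hab, ha, hb⟩ := (SimpleGraph.map_adj _ _ _ _).1 h2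
    exact ⟨a, b, hab, hg a x (by simp [ha]), hg b y (by simp [hb])⟩
  · rintro ⟨a, b, hab, rfl, rfl⟩
    have h1 : (H.map ι).Adj (ι a) (ι b) := (SimpleGraph.map_adj_apply).2 hab
    have h2 : (K.map ι).Adj (f (ι a)) (f (ι b)) := f.map_rel_iff.2 h1
    obtain ⟨x, y, hxy, hx, hy⟩ := (SimpleGraph.map_adj _ _ _ _).1 h2
    rwa [hg a x hx, hg b y hy]

lemma choose_le_mul_numGraphs {n v : ℕ} (k : ℕ) (hv : v ≤ n) :
    (v.choose 2).choose k ≤ v ^ v * numGraphs n k := by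
  classical
  rw [← card_graphs_with_edges, Nat.card_eq_fintype_card, ← Finset.card_univ]
  let ι : Fin v ↪ Fin n := Fin.castLEEmb hv
  let F : {H : SimpleGraph (Fin v) // H.edgeSet.ncard = k} →
      Quotient (isoSetoid fun G : SimpleGraph (Fin n) => G.edgeSet.ncard = k) :=
    fun H => Quotient.mk _ ⟨H.1.map ι, (ncard_edgeSet_map ι H.1).trans H.2⟩
  have hfib : ∀ c ∈ Finset.univ.image F, (Finset.univ.filter fun H => F H = c).card ≤ v ^ v := by
    intro c hc
    obtain ⟨H, -, rfl⟩ := Finset.mem_image.1 hc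
    have hex : ∀ K, F K = F H → ∃ g : Fin v → Fin v,
        ∀ x y, K.1.Adj x y ↔ ∃ a b, H.1.Adj a b ∧ g a = x ∧ g b = y := by
      intro K hK
      obtain ⟨f⟩ := Quotient.exact hK.symm
      exact exists_map_of_iso_map ι f
    have : Nonempty (Fin v → Fin v) := ⟨id⟩
    choose! g hg using hex
    have hcard : (Finset.univ : Finset (Fin v → Fin v)).card = v ^ v := by simp
    rw [← hcard]
    refine Finset.card_le_card_of_injOn g (fun _ _ => Finset.mem_coe.2 (Finset.mem_univ _)) ?_
    intro K hK L hL hKL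
    have hK' := hg K (Finset.mem_filter.1 (Finset.mem_coe.1 hK)).2
    have hL' := hg L (Finset.mem_filter.1 (Finset.mem_coe.1 hL)).2
    refine Subtype.ext ?_
    ext x y
    rw [hK', hL', hKL]
  refine (Finset.card_le_mul_card_image _ _ hfib).trans (Nat.mul_le_mul_left _ ?_)
  rw [numGraphs, Nat.card_eq_fintype_card]
  exact Finset.card_le_univ _

lemma bad_bound_le (Q n w k : ℕ) (hw : w = n / 16) (hk : k = n / 2) (hw16 : 16 ≤ w) :
    2 * (2 ^ (Q * (n + 1)) * (3 ^ n * (n : ℝ) ^ (k / 2))) * (2 * w : ℕ) ^ (2 * w) ≤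
      (2 * 2 ^ (32 * Q) * 3 ^ 32 : ℝ) ^ w * n ^ (6 * w + 4) := by
  have hn1 : (1 : ℝ) ≤ n := by exact_mod_cast (by omega : 1 ≤ n)
  calc 2 * (2 ^ (Q * (n + 1)) * (3 ^ n * (n : ℝ) ^ (k / 2))) * (2 * w : ℕ) ^ (2 * w)
      ≤ 2 ^ w * (2 ^ (32 * Q * w) * (3 ^ (32 * w) * (n : ℝ) ^ (4 * w + 4))) *
          (n : ℝ) ^ (2 * w) := by
        have h1 : Q * (n + 1) ≤ 32 * Q * w := by
          calc Q * (n + 1) ≤ Q * (32 * w) := Nat.mul_le_mul_left _ (by omega)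
            _ = 32 * Q * w := by ring
        gcongr
        · exact le_self_pow₀ (by norm_num) (by omega)
        · norm_num
        · norm_num
        · omega
        · omega
        · omega
    _ = _ := by
        rw [mul_pow, mul_pow, ← pow_mul, ← pow_mul 3]
        ring

lemma pow_le_choose_choose (n w k : ℕ) (hw : w = n / 16) (hk : k = n / 2) (hw16 : 16 ≤ w) :
    ((n : ℝ) / 153) ^ (8 * w) ≤ (((2 * w).choose 2).choose k : ℕ) := by
  have hw0 : (0 : ℝ) < w := by exact_mod_cast (by omega : 0 < w)
  have hM : w ^ 2 ≤ (2 * w).choose 2 + 1 - k := by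
    have h1 : (2 * w).choose 2 = w * (2 * w - 1) := by
      rw [Nat.choose_two_right, mul_assoc, Nat.mul_div_cancel_left _ two_pos]
    have h2 : w ^ 2 + k ≤ w * (2 * w - 1) + 1 := by
      have hk' : k ≤ 8 * w + 7 := by omega
      clear hw hk h1
      obtain ⟨u, rfl⟩ : ∃ u, w = u + 16 := ⟨w - 16, by omega⟩
      have : 2 * (u + 16) - 1 = 2 * u + 31 := by omega
      rw [this]
      nlinarith
    omega
  have hk9 : k ≤ 9 * w := by omega
  calc ((n : ℝ) / 153) ^ (8 * w) ≤ ((n : ℝ) / 153) ^ k := by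
        refine pow_le_pow_right₀ ?_ (by omega)
        rw [one_le_div (by norm_num)]
        exact_mod_cast (by omega : 153 ≤ n)
    _ ≤ ((w : ℝ) / 9) ^ k := by
        refine pow_le_pow_left₀ (by positivity) ?_ _
        rw [div_le_div_iff₀ (by norm_num) (by norm_num)]
        exact_mod_cast (by omega : n * 9 ≤ w * 153)
    _ = ((w : ℝ) ^ 2) ^ k / (9 * w) ^ k := by
        rw [← div_pow]
        congr 1
        field_simp
    _ ≤ (((2 * w).choose 2 + 1 - k : ℕ) : ℝ) ^ k / k.factorial := by
        gcongr
        · exact_mod_cast hM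
        · exact_mod_cast (Nat.factorial_le_pow k).trans (Nat.pow_le_pow_left hk9 k)
    _ ≤ _ := Nat.pow_le_choose _ _

/-- The total contribution of permutations fixing few pairs is negligible compared with a lower
bound for the number of graphs. -/
lemma bad_bound_le_choose (Q : ℕ) : ∃ M : ℕ, ∀ n : ℕ, M ≤ n →
    2 * (2 ^ (Q * (n + 1)) * (3 ^ n * (n : ℝ) ^ (n / 2 / 2))) * (2 * (n / 16) : ℕ) ^ (2 * (n / 16))
      ≤ (((2 * (n / 16)).choose 2).choose (n / 2) : ℕ) := by
  obtain ⟨K₁, hK₁⟩ : ∃ K₁ : ℝ, K₁ = 2 * 2 ^ (32 * Q) * 3 ^ 32 := ⟨_, rfl⟩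
  have hK₁0 : 0 ≤ K₁ := by rw [hK₁]; positivity
  obtain ⟨K, hK⟩ := exists_nat_ge (K₁ * 153 ^ 8)
  refine ⟨K + 272, fun n hn => ?_⟩
  have hn1 : (1 : ℝ) ≤ n := by exact_mod_cast (by omega : 1 ≤ n)
  have hKn : K₁ * 153 ^ 8 ≤ n := hK.trans (by exact_mod_cast (by omega : K ≤ n))
  obtain ⟨w, hw⟩ : ∃ w, w = n / 16 := ⟨_, rfl⟩
  obtain ⟨k, hk⟩ : ∃ k, k = n / 2 := ⟨_, rfl⟩
  rw [← hw, ← hk]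
  have hw16 : 16 ≤ w := by omega
  refine (bad_bound_le Q n w k hw hk hw16).trans
    (le_trans ?_ (pow_le_choose_choose n w k hw hk hw16))
  rw [← hK₁, div_pow, le_div_iff₀ (by positivity)]
  calc K₁ ^ w * n ^ (6 * w + 4) * 153 ^ (8 * w)
      = (K₁ * 153 ^ 8) ^ w * n ^ (6 * w + 4) := by
        rw [mul_pow, pow_mul]
        ring
    _ ≤ (n : ℝ) ^ w * n ^ (6 * w + 4) := by gcongr
    _ = (n : ℝ) ^ (7 * w + 4) := by ring
    _ ≤ (n : ℝ) ^ (8 * w) := pow_le_pow_right₀ hn1 (by omega)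

/-- The number of graphs with slightly more than `n / 2` edges exceeds the number of graphs with
`n / 2` edges by an arbitrarily large factor. -/
lemma numGraphs_growth (C m : ℕ) (hC : 0 < C) : ∃ M : ℕ, ∀ n : ℕ, M ≤ n → ∀ j, 0 < j → j ≤ m →
    C * numGraphs n (n / 2) ≤ numGraphs n (n / 2 + j) := by
  classical
  obtain ⟨M, hM⟩ := bad_bound_le_choose (2 * C + 1)
  refine ⟨M + 2 * m + 32, fun n hn j hj hjm => ?_⟩
  set k := n / 2 with hk
  set Q := (2 * C + 1) * (n + 1) with hQ
  let good : Finset (Equiv.Perm (Fin n)) :=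
    Finset.univ.filter fun σ => Q ≤ (fixedFinset (pairPerm σ)).card
  let I : ℕ → Equiv.Perm (Fin n) → ℕ := fun i σ => (invariantSets (pairPerm σ) i).card
  have hgood : 2 * C * ∑ σ ∈ good, I k σ ≤ ∑ σ ∈ good, I (k + j) σ := by
    rw [Finset.mul_sum]
    refine Finset.sum_le_sum fun σ hσ => ?_
    exact card_invariantSets_add _ (Finset.mem_filter.1 hσ).2 j hj hC (by omega)
  have hle : ∑ σ ∈ good, I (k + j) σ ≤ numGraphs n (k + j) * n.factorial := by
    rw [← burnside_graphs]
    exact Finset.sum_le_sum_of_subset (Finset.filter_subset _ _)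
  have hsplit : ∑ σ ∈ good, I k σ + ∑ σ ∈ goodᶜ, I k σ = numGraphs n k * n.factorial := by
    rw [← burnside_graphs]
    exact Finset.sum_add_sum_compl _ _
  set B : ℝ := 2 ^ Q * (3 ^ n * (n : ℝ) ^ (k / 2)) with hB
  have hbad : ((∑ σ ∈ goodᶜ, I k σ : ℕ) : ℝ) ≤ n.factorial * B := by
    rw [Nat.cast_sum]
    calc ∑ σ ∈ goodᶜ, (I k σ : ℝ) ≤ ∑ σ ∈ goodᶜ, B := by
          refine Finset.sum_le_sum fun σ hσ => ?_
          have hσ' : (fixedFinset (pairPerm σ)).card ≤ Q := by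
            simp only [good, Finset.mem_compl, Finset.mem_filter, Finset.mem_univ, true_and,
              not_le] at hσ
            exact hσ.le
          have hX : Fintype.card (Pairs (Fin n)) ≤ n * n := by
            rw [card_pairs, ← sq]
            exact Nat.choose_le_pow n 2
          refine (card_invariantSets_le (pairPerm σ) (n := n) (by omega) hX).trans ?_
          rw [hB]
          gcongr
          norm_num
      _ = (goodᶜ.card : ℝ) * B := by rw [Finset.sum_const, nsmul_eq_mul]
      _ ≤ n.factorial * B := by
          have : goodᶜ.card ≤ n.factorial :=
            (Finset.card_le_univ _).trans (by rw [Fintype.card_perm, Fintype.card_fin])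
          gcongr
  have hbig : 2 * B ≤ numGraphs n k := by
    have h1 := hM n (by omega)
    have h2 : ((((2 * (n / 16)).choose 2).choose k : ℕ) : ℝ) ≤
        ((2 * (n / 16) : ℕ) : ℝ) ^ (2 * (n / 16)) * numGraphs n k := by
      exact_mod_cast choose_le_mul_numGraphs (n := n) k (by omega)
    have hpos : (0 : ℝ) < ((2 * (n / 16) : ℕ) : ℝ) ^ (2 * (n / 16)) := by
      have : 0 < 2 * (n / 16) := by omega
      positivity
    refine le_of_mul_le_mul_right ?_ hpos
    rw [mul_comm (numGraphs n k : ℝ)]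
    exact h1.trans h2
  have hfac : (0 : ℝ) < n.factorial := by exact_mod_cast n.factorial_pos
  have hbad2 : 2 * ∑ σ ∈ goodᶜ, I k σ ≤ numGraphs n k * n.factorial := by
    have : ((2 * ∑ σ ∈ goodᶜ, I k σ : ℕ) : ℝ) ≤ ((numGraphs n k * n.factorial : ℕ) : ℝ) := by
      rw [Nat.cast_mul 2, Nat.cast_mul (numGraphs n k)]
      push_cast at hbad ⊢
      nlinarith
    exact_mod_cast this
  refine Nat.le_of_mul_le_mul_right ?_ n.factorial_pos
  have h3 : C * (numGraphs n k * n.factorial) ≤ C * (2 * ∑ σ ∈ good, I k σ) :=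
    Nat.mul_le_mul_left _ (by omega)
  calc C * numGraphs n k * n.factorial = C * (numGraphs n k * n.factorial) := by ring
    _ ≤ _ := h3
    _ = 2 * C * ∑ σ ∈ good, I k σ := by ring
    _ ≤ _ := hgood.trans hle

/-- A graph has at most one isolated vertex. -/
def AtMostOneIsolated {V : Type} (G : SimpleGraph V) : Prop :=
  ∀ a b, (∀ w, ¬ G.Adj a w) → (∀ w, ¬ G.Adj b w) → a = b

/-- A large graph with at most one isolated vertex and few edges has an isolated edge. -/
lemma exists_isolated_edge_s19 {V : Type} [Fintype V] (G : SimpleGraph V) (c : ℕ)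
    (hiso : AtMostOneIsolated G)
    (hdeg : ∑ v, (G.neighborSet v).ncard ≤ Fintype.card V + c) (hV : 3 * c + 4 < Fintype.card V) :
    ∃ a b, G.Adj a b ∧ (∀ x, G.Adj a x → x = b) ∧ (∀ x, G.Adj b x → x = a) := by
  classical
  by_contra! hno
  let d : V → ℕ := fun v => (G.neighborSet v).ncard
  let I := Finset.univ.filter fun v => d v = 0
  let L := Finset.univ.filter fun v => d v = 1
  let T := Finset.univ.filter fun v => 2 ≤ d v
  have hcardI : I.card ≤ 1 := by
    have hI : ∀ v ∈ I, ∀ w, ¬ G.Adj v w := by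
      intro v hv w hvw
      have h0 : (G.neighborSet v).ncard = 0 := (Finset.mem_filter.1 hv).2
      rw [Set.ncard_eq_zero] at h0
      have : w ∈ G.neighborSet v := hvw
      rw [h0] at this
      exact this
    exact Finset.card_le_one.2 fun a ha b hb => hiso a b (hI a ha) (hI b hb)
  have hsplit : ∀ f : V → ℕ, ∑ v, f v = ∑ v ∈ I, f v + ∑ v ∈ L, f v + ∑ v ∈ T, f v := by
    intro f
    simp only [I, L, T, Finset.sum_filter, ← Finset.sum_add_distrib]
    refine Finset.sum_congr rfl fun v _ => ?_
    rcases h : d v with _ | _ | t <;> simp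
  have hcard : Fintype.card V = I.card + L.card + T.card := by
    simpa using hsplit fun _ => 1
  have hsum := hsplit d
  have hIs : ∑ v ∈ I, d v = 0 := Finset.sum_eq_zero fun v hv => (Finset.mem_filter.1 hv).2
  have hLs : ∑ v ∈ L, d v = L.card := by
    rw [Finset.card_eq_sum_ones]
    exact Finset.sum_congr rfl fun v hv => (Finset.mem_filter.1 hv).2
  have hTs : 2 * T.card ≤ ∑ v ∈ T, d v := by
    rw [mul_comm, ← smul_eq_mul]
    exact Finset.card_nsmul_le_sum _ _ _ fun v hv => (Finset.mem_filter.1 hv).2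
  have hLT : L.card ≤ ∑ v ∈ T, d v := by
    calc L.card ≤ (T.biUnion fun v => (G.neighborSet v).toFinset).card := by
          refine Finset.card_le_card fun a ha => ?_
          have ha1 : (G.neighborSet a).ncard = 1 := (Finset.mem_filter.1 ha).2
          obtain ⟨b, hb⟩ := Set.ncard_eq_one.1 ha1
          have hab : G.Adj a b := by
            have : b ∈ G.neighborSet a := by rw [hb]; rfl
            exact this
          obtain ⟨x, hbx, hxa⟩ := hno a b hab fun x hx => by
            have : x ∈ G.neighborSet a := hx
            rw [hb] at this
            exact this
          simp only [Finset.mem_biUnion, Set.mem_toFinset]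
          refine ⟨b, Finset.mem_filter.2 ⟨Finset.mem_univ _, ?_⟩, hab.symm⟩
          have hsub : ({x, a} : Set V) ⊆ G.neighborSet b := by
            rintro y (rfl | rfl)
            · exact hbx
            · exact hab.symm
          calc 2 = ({x, a} : Set V).ncard := (Set.ncard_pair hxa).symm
            _ ≤ _ := Set.ncard_le_ncard hsub
      _ ≤ ∑ v ∈ T, (G.neighborSet v).toFinset.card := Finset.card_biUnion_le
      _ = ∑ v ∈ T, d v := Finset.sum_congr rfl fun v _ => (Set.ncard_eq_toFinset_card' _).symm
  have hdeg' : ∑ v, d v ≤ Fintype.card V + c := hdeg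
  omega

/-- There is an enumeration of the vertices whose last two entries are given distinct vertices. -/
lemma exists_equiv_last_two {n : ℕ} {a b : Fin (n + 2)} (hab : a ≠ b) :
    ∃ e : Fin n ⊕ Fin 2 ≃ Fin (n + 2), e (Sum.inr 0) = a ∧ e (Sum.inr 1) = b := by
  let e₀ : Fin n ⊕ Fin 2 ≃ Fin (n + 2) := finSumFinEquiv
  let y := Equiv.swap (e₀ (Sum.inr 0)) a (e₀ (Sum.inr 1))
  have hy : a ≠ y := by
    intro h
    have h1 : Equiv.swap (e₀ (Sum.inr 0)) a (e₀ (Sum.inr 0)) = y := by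
      rw [Equiv.swap_apply_left]; exact h
    have h2 := e₀.injective ((Equiv.swap (e₀ (Sum.inr 0)) a).injective h1)
    simp at h2
  refine ⟨(e₀.trans (Equiv.swap (e₀ (Sum.inr 0)) a)).trans (Equiv.swap y b), ?_, ?_⟩
  · simp only [Equiv.trans_apply, Equiv.swap_apply_left]
    exact Equiv.swap_apply_of_ne_of_ne hy hab
  · simp only [Equiv.trans_apply]
    exact Equiv.swap_apply_left _ _

/-- Add an isolated edge to a graph. -/
def addIsolatedEdge {n : ℕ} (H : SimpleGraph (Fin n)) : SimpleGraph (Fin (n + 2)) :=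
  (H ⊕g (⊤ : SimpleGraph (Fin 2))).comap (finSumFinEquiv (m := n) (n := 2)).symm

/-- Removing an isolated edge preserves the relevant sparsity conditions. -/
lemma exists_remove_isolated_edge {n c : ℕ} (G : SimpleGraph (Fin (n + 2)))
    (hiso : AtMostOneIsolated G) (hdeg : ∑ v, (G.neighborSet v).ncard ≤ n + 2 + c)
    (hn : 3 * c + 4 < n + 2) :
    ∃ H : SimpleGraph (Fin n), AtMostOneIsolated H ∧
      ∑ v, (H.neighborSet v).ncard ≤ n + c ∧
      Nonempty (G ≃g (H ⊕g (⊤ : SimpleGraph (Fin 2)))) := by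
  obtain ⟨a, b, hab, ha, hb⟩ :=
    exists_isolated_edge_s19 G c hiso (by simpa using hdeg) (by simpa using hn)
  obtain ⟨e, rfl, rfl⟩ := exists_equiv_last_two hab.ne
  have hna : ∀ v, ¬ G.Adj (e (Sum.inr 0)) (e (Sum.inl v)) := fun v h => by
    simpa using ha _ h
  have hnb : ∀ v, ¬ G.Adj (e (Sum.inr 1)) (e (Sum.inl v)) := fun v h => by
    simpa using hb _ h
  refine ⟨G.comap (e ∘ Sum.inl), ?_, ?_, ⟨⟨e.symm, ?_⟩⟩⟩
  · have key : ∀ v : Fin n, (∀ w, ¬ (G.comap (e ∘ Sum.inl)).Adj v w) →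
        ∀ w, ¬ G.Adj (e (Sum.inl v)) w := by
      intro v hv w
      obtain ⟨x, rfl⟩ := e.surjective w
      rcases x with x | x
      · exact hv x
      · fin_cases x
        · exact fun h => hna v h.symm
        · exact fun h => hnb v h.symm
    intro x y hx hy
    simpa using hiso _ _ (key x hx) (key y hy)
  · have hsum : ∑ v, (G.neighborSet v).ncard =
        ∑ v : Fin n, (G.neighborSet (e (Sum.inl v))).ncard +
          ((G.neighborSet (e (Sum.inr 0))).ncard + (G.neighborSet (e (Sum.inr 1))).ncard) := by
      rw [← Equiv.sum_comp e, Fintype.sum_sum_type, Fin.sum_univ_two]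
    have hle : ∑ v : Fin n, ((G.comap (e ∘ Sum.inl)).neighborSet v).ncard ≤
        ∑ v : Fin n, (G.neighborSet (e (Sum.inl v))).ncard := by
      refine Finset.sum_le_sum fun v _ => ?_
      refine Set.ncard_le_ncard_of_injOn (e ∘ Sum.inl) (fun w hw => hw) ?_
      exact (e.injective.comp Sum.inl_injective).injOn
    have h0 : 0 < (G.neighborSet (e (Sum.inr 0))).ncard :=
      (Set.ncard_pos).2 ⟨_, hab⟩
    have h1 : 0 < (G.neighborSet (e (Sum.inr 1))).ncard :=
      (Set.ncard_pos).2 ⟨_, hab.symm⟩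
    omega
  · intro x y
    obtain ⟨x, rfl⟩ := e.surjective x
    obtain ⟨y, rfl⟩ := e.surjective y
    simp only [Equiv.symm_apply_apply]
    rcases x with x | x <;> rcases y with y | y
    · simp
    · simp only [SimpleGraph.not_adj_sum_inl_inr, false_iff]
      fin_cases y
      · exact fun h => hna x h.symm
      · exact fun h => hnb x h.symm
    · rw [SimpleGraph.adj_comm, G.adj_comm]
      simp only [SimpleGraph.not_adj_sum_inl_inr, false_iff]
      fin_cases x
      · exact fun h => hna y h.symm
      · exact fun h => hnb y h.symm
    · fin_cases x <;> fin_cases y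
      · simp
      · simpa using hab
      · simpa using hab.symm
      · simp

/-- Up to isomorphism, there are boundedly many graphs with at most one isolated vertex and
average degree close to one. -/
lemma exists_bounded_family (c : ℕ) : ∃ C : ℕ, 0 < C ∧ ∀ n : ℕ,
    ∃ F : Finset (SimpleGraph (Fin n)), F.card ≤ C ∧ ∀ G : SimpleGraph (Fin n),
      AtMostOneIsolated G → ∑ v, (G.neighborSet v).ncard ≤ n + c →
        ∃ H ∈ F, Nonempty (G ≃g H) := by
  classical
  refine ⟨∑ i ∈ Finset.range (3 * c + 5), Fintype.card (SimpleGraph (Fin i)) + 1, by omega,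
    fun n => ?_⟩
  induction n using Nat.strong_induction_on with
  | _ n ih =>
  by_cases hn : n < 3 * c + 5
  · refine ⟨Finset.univ, ?_, fun G _ _ => ⟨G, Finset.mem_univ _, ⟨SimpleGraph.Iso.refl⟩⟩⟩
    rw [Finset.card_univ]
    exact (Finset.single_le_sum (f := fun i => Fintype.card (SimpleGraph (Fin i)))
      (fun _ _ => Nat.zero_le _) (Finset.mem_range.2 hn)).trans (Nat.le_succ _)
  · obtain ⟨n, rfl⟩ : ∃ n', n = n' + 2 := ⟨n - 2, by omega⟩
    obtain ⟨F, hF, hcov⟩ := ih n (by omega)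
    refine ⟨F.image addIsolatedEdge, Finset.card_image_le.trans hF, fun G hiso hdeg => ?_⟩
    obtain ⟨H, hH1, hH2, ⟨f⟩⟩ := exists_remove_isolated_edge (c := c) G hiso hdeg (by omega)
    obtain ⟨K, hK, ⟨g⟩⟩ := hcov H hH1 hH2
    refine ⟨addIsolatedEdge K, Finset.mem_image_of_mem _ hK, ⟨?_⟩⟩
    exact (f.trans (SimpleGraph.Iso.sumCongr g SimpleGraph.Iso.refl)).trans
      (SimpleGraph.Iso.comap (finSumFinEquiv (m := n) (n := 2)).symm _).symm

lemma sum_ncard_neighborSet {V : Type} [Fintype V] (G : SimpleGraph V) :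
    ∑ v, (G.neighborSet v).ncard = 2 * G.edgeSet.ncard := by
  classical
  rw [Set.ncard_eq_toFinset_card' G.edgeSet]
  refine Eq.trans (Finset.sum_congr rfl fun v _ => ?_) G.sum_degrees_eq_twice_card_edges
  rw [Set.ncard_eq_toFinset_card']
  rfl

lemma UniversallySolvable.atMostOneIsolated_compl {V : Type} [Fintype V] [DecidableEq V]
    {G : SimpleGraph V} (hG : UniversallySolvable G) : AtMostOneIsolated Gᶜ := by
  intro a b ha hb
  by_contra hab
  have row : ∀ v, (∀ w, ¬ Gᶜ.Adj v w) → nbhdMatrix G v = fun _ => 1 := by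
    intro v hv
    funext w
    have : v = w ∨ G.Adj v w := by
      have := hv w
      rw [SimpleGraph.compl_adj] at this
      tauto
    simp [nbhdMatrix, this]
  have hdet := (Matrix.isUnit_iff_isUnit_det _).1 hG
  rw [Matrix.det_zero_of_row_eq hab ((row a ha).trans (row b hb).symm)] at hdet
  exact not_isUnit_zero hdet

/-- A graph with at most one isolated vertex has at least `⌊n / 2⌋` edges. -/
lemma AtMostOneIsolated.half_le_ncard_edgeSet {n : ℕ} {G : SimpleGraph (Fin n)}
    (hG : AtMostOneIsolated G) : n / 2 ≤ G.edgeSet.ncard := by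
  classical
  let I : Finset (Fin n) := Finset.univ.filter fun v => ∀ w, ¬ G.Adj v w
  have hI : I.card ≤ 1 := Finset.card_le_one.2 fun a ha b hb =>
    hG a b (Finset.mem_filter.1 ha).2 (Finset.mem_filter.1 hb).2
  have hIc : Iᶜ.card ≤ ∑ v, (G.neighborSet v).ncard := by
    calc Iᶜ.card = ∑ v ∈ Iᶜ, 1 := Finset.card_eq_sum_ones _
      _ ≤ ∑ v ∈ Iᶜ, (G.neighborSet v).ncard := by
          refine Finset.sum_le_sum fun v hv => ?_
          simp only [I, Finset.mem_compl, Finset.mem_filter, Finset.mem_univ, true_and,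
            not_forall, not_not] at hv
          exact (Set.ncard_pos).2 hv
      _ ≤ _ := Finset.sum_le_sum_of_subset (Finset.subset_univ _)
  rw [sum_ncard_neighborSet] at hIc
  have : I.card + Iᶜ.card = n := by rw [Finset.card_add_card_compl, Fintype.card_fin]
  omega

/-- An isomorphism between complements gives an isomorphism between the graphs. -/
def isoOfComplIso {V W : Type} {G : SimpleGraph V} {H : SimpleGraph W} (f : Gᶜ ≃g Hᶜ) : G ≃g H where
  toEquiv := f.toEquiv
  map_rel_iff' {a b} := by
    have h := f.map_rel_iff (a := a) (b := b)
    simp only [SimpleGraph.compl_adj] at h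
    by_cases hab : a = b
    · subst hab; simp
    · have hne : f a ≠ f b := fun h => hab (f.injective h)
      change H.Adj (f a) (f b) ↔ G.Adj a b
      tauto

lemma numGraphs_compl_le {n k l : ℕ} (h : n.choose 2 - k = l) :
    numGraphs n k ≤ numGraphs n l := by
  refine Nat.card_le_card_of_injective (Quotient.lift
    (fun G => Quotient.mk _ ⟨G.1ᶜ, by rw [ncard_edgeSet_compl, G.2, h]⟩) ?_) ?_
  · rintro G H ⟨f⟩
    refine Quotient.sound ⟨isoOfComplIso ?_⟩
    simpa only [compl_compl] using f
  · intro x y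
    induction x using Quotient.inductionOn with | _ G =>
    induction y using Quotient.inductionOn with | _ H =>
    intro hxy
    obtain ⟨f⟩ := Quotient.exact hxy
    exact Quotient.sound ⟨isoOfComplIso f⟩

lemma numGraphs_compl {n k : ℕ} (hk : k ≤ n.choose 2) :
    numGraphs n (n.choose 2 - k) = numGraphs n k :=
  (numGraphs_compl_le (by omega)).antisymm (numGraphs_compl_le rfl)

lemma numSolvableGraphs_eq_zero {n k : ℕ} (hkn : k ≤ n.choose 2) (hk : k < n / 2) :
    numSolvableGraphs n (n.choose 2 - k) = 0 := by
  rw [numSolvableGraphs, Nat.card_eq_zero]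
  left
  refine ⟨fun x => ?_⟩
  induction x using Quotient.inductionOn with | _ G =>
  have h := G.2.2.atMostOneIsolated_compl.half_le_ncard_edgeSet
  rw [ncard_edgeSet_compl, G.2.1] at h
  omega

lemma numSolvableGraphs_le {n k c C : ℕ} (hkn : k ≤ n.choose 2) (hk : 2 * k ≤ n + c)
    (F : Finset (SimpleGraph (Fin n))) (hF : F.card ≤ C)
    (hcov : ∀ G : SimpleGraph (Fin n), AtMostOneIsolated G →
      ∑ v, (G.neighborSet v).ncard ≤ n + c → ∃ H ∈ F, Nonempty (G ≃g H)) :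
    numSolvableGraphs n (n.choose 2 - k) ≤ C := by
  have hex : ∀ x : Quotient (isoSetoid fun G : SimpleGraph (Fin n) =>
      G.edgeSet.ncard = n.choose 2 - k ∧ UniversallySolvable G),
      ∃ H : F, ∃ G, Quotient.mk _ G = x ∧ Nonempty (G.1ᶜ ≃g H.1) := by
    intro x
    induction x using Quotient.inductionOn with | _ G =>
    obtain ⟨H, hH, hf⟩ := hcov G.1ᶜ G.2.2.atMostOneIsolated_compl (by
      rw [sum_ncard_neighborSet, ncard_edgeSet_compl, G.2.1]
      omega)
    exact ⟨⟨H, hH⟩, G, rfl, hf⟩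
  choose φ hφ using hex
  refine le_trans ?_ hF
  rw [numSolvableGraphs, ← Fintype.card_coe, ← Nat.card_eq_fintype_card]
  refine Nat.card_le_card_of_injective φ ?_
  intro x y hxy
  obtain ⟨G, rfl, ⟨f⟩⟩ := hφ x
  obtain ⟨H, rfl, ⟨g⟩⟩ := hφ y
  rw [← hxy] at g
  exact Quotient.sound ⟨isoOfComplIso (f.trans g.symm)⟩

/-- The graph on `Fin n` with edges `{0, 1}`, `{2, 3}`, … -/
def matchingGraph (n : ℕ) : SimpleGraph (Fin n) where
  Adj i j := i ≠ j ∧ i.1 / 2 = j.1 / 2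
  symm := ⟨fun _ _ h => ⟨h.1.symm, h.2.symm⟩⟩
  loopless := ⟨fun _ h => h.1 rfl⟩

lemma matchingGraph_adj {n : ℕ} {i j : Fin n} :
    (matchingGraph n).Adj i j ↔ i.1 ≠ j.1 ∧ i.1 / 2 = j.1 / 2 := by
  rw [← Fin.ext_iff.ne]
  rfl

lemma matchingGraph_isolated_iff {n : ℕ} (i : Fin n) :
    (∀ j, ¬ (matchingGraph n).Adj i j) ↔ i.1 + 1 = n ∧ n % 2 = 1 := by
  have hi := i.2
  constructor
  · intro h
    by_contra hcon
    by_cases hp : i.1 % 2 = 0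
    · exact h ⟨i.1 + 1, by omega⟩ (matchingGraph_adj.2 ⟨by simp, by simp only; omega⟩)
    · exact h ⟨i.1 - 1, by omega⟩ (matchingGraph_adj.2 ⟨by simp only; omega, by simp only; omega⟩)
  · rintro ⟨h1, h2⟩ j hj
    have := j.2
    rw [matchingGraph_adj] at hj
    omega

lemma atMostOneIsolated_matchingGraph (n : ℕ) : AtMostOneIsolated (matchingGraph n) := by
  intro a b ha hb
  rw [matchingGraph_isolated_iff] at ha hb
  rw [Fin.ext_iff]
  omega

lemma ncard_edgeSet_matchingGraph (n : ℕ) : (matchingGraph n).edgeSet.ncard = n / 2 := by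
  refine le_antisymm ?_ (atMostOneIsolated_matchingGraph n).half_le_ncard_edgeSet
  have h : ∑ v, ((matchingGraph n).neighborSet v).ncard ≤ ∑ v : Fin n, 1 := by
    refine Finset.sum_le_sum fun v _ => ?_
    rw [Set.ncard_le_one_iff]
    intro a b ha hb
    rw [SimpleGraph.mem_neighborSet, matchingGraph_adj] at ha hb
    rw [Fin.ext_iff]
    omega
  rw [sum_ncard_neighborSet] at h
  simp at h
  omega

lemma universallySolvable_compl_matchingGraph (n : ℕ) :
    UniversallySolvable (matchingGraph n)ᶜ := by
  classical
  rw [UniversallySolvable, ← Matrix.mulVec_injective_iff_isUnit]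
  refine (injective_iff_map_eq_zero (Matrix.mulVecLin (nbhdMatrix (matchingGraph n)ᶜ))).2 ?_
  intro v hv
  have hrow : ∀ i, ∑ j, v j = ∑ j, if (matchingGraph n).Adj i j then v j else 0 := by
    intro i
    have h := congrFun hv i
    simp only [Matrix.mulVecLin_apply, Matrix.mulVec, dotProduct, nbhdMatrix, Matrix.of_apply,
      SimpleGraph.compl_adj, Pi.zero_apply] at h
    rw [← sub_eq_zero, ← Finset.sum_sub_distrib]
    refine Eq.trans (Finset.sum_congr rfl fun j _ => ?_) h
    by_cases hA : (matchingGraph n).Adj i j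
    · simp [hA, hA.ne]
    · by_cases hij : i = j <;> simp [hA, hij]
  have hpair : ∀ i j, (matchingGraph n).Adj i j → v j = ∑ l, v l := by
    intro i j hij
    rw [hrow i, Finset.sum_eq_single j]
    · simp [hij]
    · intro l _ hl
      have : ¬ (matchingGraph n).Adj i l := by
        intro h
        rw [matchingGraph_adj] at h hij
        rw [Ne, Fin.ext_iff] at hl
        omega
      simp [this]
    · simp
  have hzero : ∑ l, v l = 0 := by
    rcases Nat.mod_two_eq_zero_or_one n with hn | hn
    · have hconst : ∀ i, v i = ∑ l, v l := by
        intro i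
        have hi : ¬ ∀ j, ¬ (matchingGraph n).Adj i j := by
          rw [matchingGraph_isolated_iff]
          omega
        push Not at hi
        obtain ⟨j, hj⟩ := hi
        exact hpair j i hj.symm
      rw [Finset.sum_congr rfl fun i _ => hconst i, Finset.sum_const, Finset.card_univ,
        Fintype.card_fin, nsmul_eq_mul, (ZMod.natCast_eq_zero_iff n 2).2 (Nat.dvd_of_mod_eq_zero hn),
        zero_mul]
    · have hiso := (matchingGraph_isolated_iff (⟨n - 1, by omega⟩ : Fin n)).2
        ⟨by simp only; omega, hn⟩
      rw [hrow ⟨n - 1, by omega⟩]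
      exact Finset.sum_eq_zero fun j _ => if_neg (hiso j)
  have hnonisolated : ∀ i, (∃ j, (matchingGraph n).Adj i j) → v i = 0 := by
    rintro i ⟨j, hj⟩
    rw [hpair j i hj.symm, hzero]
  funext i
  by_cases hi : ∀ j, ¬ (matchingGraph n).Adj i j
  · rw [Finset.sum_eq_single i] at hzero
    · exact hzero
    · intro j _ hji
      refine hnonisolated j ?_
      by_contra! hj
      exact hji (atMostOneIsolated_matchingGraph n j i hj hi)
    · simp
  · push Not at hi
    exact hnonisolated i hi

lemma numSolvableGraphs_pos (n : ℕ) :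
    0 < numSolvableGraphs n (n.choose 2 - n / 2) := by
  rw [numSolvableGraphs, Nat.card_pos_iff]
  refine ⟨⟨Quotient.mk _ ⟨(matchingGraph n)ᶜ, ?_, universallySolvable_compl_matchingGraph n⟩⟩,
    inferInstance⟩
  rw [ncard_edgeSet_compl, ncard_edgeSet_matchingGraph]

/-- For every positive integer `m` there is a positive integer `M` such that for all
`n > M` and all `e` with `N - ⌊n/2⌋ - m ≤ e ≤ N` (where `N = n(n-1)/2`), the probability
`P_{n,e}` is maximized at `e = N - ⌊n/2⌋`. -/
theorem solvProb_max_at_N_sub_half (m : ℕ) (hm : 0 < m) :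
    ∃ M : ℕ, 0 < M ∧ ∀ n : ℕ, M < n → ∀ e : ℕ,
      n * (n - 1) / 2 - n / 2 - m ≤ e → e ≤ n * (n - 1) / 2 →
      solvProb n e ≤ solvProb n (n * (n - 1) / 2 - n / 2) := by
  obtain ⟨C, hC, hfam⟩ := exists_bounded_family (2 * m)
  obtain ⟨M, hM⟩ := numGraphs_growth C m hC
  refine ⟨M + 2 * m + 4, by omega, fun n hn e he heN => ?_⟩
  rw [← Nat.choose_two_right] at he heN ⊢
  have hN : n / 2 + m ≤ n.choose 2 := by
    have h1 : n ≤ n.choose 2 := by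
      rw [Nat.choose_two_right, Nat.le_div_iff_mul_le two_pos]
      exact Nat.mul_le_mul_left _ (by omega)
    omega
  obtain ⟨k, hk, rfl⟩ : ∃ k, k ≤ n.choose 2 ∧ e = n.choose 2 - k :=
    ⟨n.choose 2 - e, by omega, by omega⟩
  have hkm : k ≤ n / 2 + m := by omega
  rcases lt_trichotomy k (n / 2) with hlt | rfl | hgt
  · rw [solvProb, numSolvableGraphs_eq_zero hk hlt]
    simp only [Nat.cast_zero, zero_div]
    exact div_nonneg (Nat.cast_nonneg _) (Nat.cast_nonneg _)
  · exact le_rfl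
  · obtain ⟨F, hF, hcov⟩ := hfam n
    have hS : numSolvableGraphs n (n.choose 2 - k) ≤ C :=
      numSolvableGraphs_le hk (by omega) F hF hcov
    have hgrow := hM n (by omega) (k - n / 2) (by omega) (by omega)
    rw [Nat.add_sub_cancel' hgt.le] at hgrow
    have hpos := numSolvableGraphs_pos n
    have hG : 0 < numGraphs n (n / 2) := by
      rw [← numGraphs_compl (by omega)]
      refine Nat.card_pos_iff.2 ⟨⟨Quotient.mk _ ⟨(matchingGraph n)ᶜ, ?_⟩⟩, inferInstance⟩
      rw [ncard_edgeSet_compl, ncard_edgeSet_matchingGraph]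
    rw [solvProb, solvProb, numGraphs_compl hk, numGraphs_compl (by omega)]
    have hG' : 0 < numGraphs n k := lt_of_lt_of_le (Nat.mul_pos hC hG) hgrow
    rw [div_le_div_iff₀ (by exact_mod_cast hG') (by exact_mod_cast hG)]
    norm_cast
    calc _ ≤ C * numGraphs n (n / 2) := Nat.mul_le_mul_right _ hS
      _ ≤ numGraphs n k := hgrow
      _ ≤ _ := Nat.le_mul_of_pos_left _ hpos
end
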